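/- Among the Sidon sets of size 13 contained in [1,111], no three are pairwise disjoint. -/

import Mathlib

/-- A set of integers is a Sidon set if `a+b = c+d` with all four in `S`
implies `{a,b} = {c,d}`. -/
def IsSidon (S : Set ℤ) : Prop :=
  ∀ a ∈ S, ∀ b ∈ S, ∀ c ∈ S, ∀ d ∈ S, a + b = c + d → ({a, b} : Set ℤ) = {c, d}

set_option maxRecDepth 1000000

noncomputable section

namespace Golomb

/-- Lists of natural numbers. A list `M` is read as a bit matrix: bit `i` of entry `p` tells
whether `p` belongs to the `i`-th set (the `i`-th lane) described by `M`. All computations below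
treat the lanes in parallel. The definitions use recursors and results in `Bool` (passing
continuations), so that the kernel evaluates them quickly. -/
inductive NL where
  | nil : NL
  | cons : Nat → NL → NL

/-- Lists of quintuples of natural numbers. -/
inductive RL where
  | nil : RL
  | cons : Nat → Nat → Nat → Nat → Nat → RL → RL

/-- Lists of bit matrices, each with its number of lanes. -/
inductive TL where
  | nil : TL
  | cons : Nat → NL → TL → TL

/-- Lists of triples of natural numbers. -/
inductive SL where
  | nil : SL
  | cons : Nat → Nat → Nat → SL → SL

open NL

def hd (l : NL) : Nat := NL.rec 0 (fun h _ _ => h) l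

def tl (l : NL) : NL := NL.rec nil (fun _ t _ => t) l

def app (l m : NL) : NL := NL.rec m (fun x _ ih => cons x ih) l

def zeros (n : Nat) : NL := Nat.rec nil (fun _ ih => cons 0 ih) n

/-- The first `n` entries, reversed. -/
def revN (n : Nat) : NL → NL → NL :=
  Nat.rec (fun _ a => a) (fun _ ih l a => ih (tl l) (cons (hd l) a)) n

def orAll (l : NL) : Nat := NL.rec 0 (fun x _ ih => Nat.lor x ih) l

def zor (l : NL) : NL → NL := NL.rec (fun ys => ys)
  (fun x xs ih ys => NL.rec (cons x xs) (fun y t _ => cons (Nat.lor x y) (ih t)) ys) l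

def shl (s : Nat) (l : NL) : NL := NL.rec nil (fun x _ ih => cons (Nat.shiftLeft x s) ih) l

/-- The lanes in which the two sets meet. -/
def dot (l : NL) : NL → Nat := NL.rec (fun _ => 0)
  (fun x _ ih ys => NL.rec 0 (fun y t _ =>
    Bool.rec (Nat.lor (Nat.land x y) (ih t)) (ih t) (Nat.beq (Nat.land x y) 0)) ys) l

/-- Complement within `m`, with `0` standing for everything when the row is empty. -/
def cpl (m : Nat) (l : NL) : NL :=
  NL.rec nil (fun x _ ih => cons (Bool.rec (Nat.xor m x) 0 (Nat.beq x 0)) ih) l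

/-- Intersection, with `0` standing for everything in the second argument. -/
def cut (x n : Nat) : Nat := Bool.rec (Nat.land x n) x (Nat.beq n 0)

/-- Differences `1, …, n`, where `D` is the tail of `M`. -/
def diffs (M : NL) (n : Nat) : NL → NL :=
  Nat.rec (fun _ => nil) (fun _ ih D => cons (dot M D) (ih (tl D))) n

/-- Sums from `s`, where `P` is the reversed prefix before `s` and `Q` the suffix from `s`. -/
def sums (M : NL) (n : Nat) : NL → NL → NL :=
  Nat.rec (fun _ _ => nil)
    (fun _ ih P Q => cons (dot (cons (hd Q) P) M) (ih (cons (hd Q) P) (tl Q))) n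

/-- Update of the threshold counters `T` by a new row. -/
def thr (T : NL) : Nat → Nat → NL :=
  NL.rec (fun _ _ => nil) (fun t _ ih p m => cons (Nat.lor t (Nat.land p m)) (ih t m)) T

def nth (n : Nat) : NL → Nat := Nat.rec (fun l => hd l) (fun _ ih l => ih (tl l)) n

/-- The lanes that can be extended by `1, 2, …, K`, with exactly `k + 1` smaller elements. -/
def cands (m0 k : Nat) (U : NL) (K : Nat) : NL → NL → NL → NL → NL :=
  Nat.rec (fun _ _ _ _ => nil) (fun _ ih P Q S T =>
    (fun T' => cons (Nat.land (nth k T') (Nat.xor m0 (Nat.lor (Nat.lor (nth (Nat.succ k) T') (hd Q))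
        (Nat.lor (hd S) (Nat.lor (dot P U) (dot (tl Q) U))))))
      (ih (cons (hd Q) P) (tl Q) (tl (tl S)) T')) (thr T m0 (hd Q))) K

/-- One more entry in front of `R0`: how many later elements can follow, level by level. -/
def inner (g : Nat) (R0 : RL) (R : RL) : NL → NL → NL → NL →
    Nat → Nat → Nat → Nat → Nat → Nat → Nat → Nat → Nat → Nat → RL :=
  RL.rec (fun _ _ _ _ a1 a2 a3 a4 b1 b2 b3 c1 c2 d1 =>
      RL.cons g (Nat.land g a1) (Nat.land g (Nat.land a2 b1))
        (Nat.land g (Nat.land a3 (Nat.land b2 c1)))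
        (Nat.land g (Nat.land a4 (Nat.land b3 (Nat.land c2 d1)))) R0)
    (fun r1 r2 r3 r4 _ _ ih U P Q S a1 a2 a3 a4 b1 b2 b3 c1 c2 d1 =>
      (fun x => (fun x2 => (fun x3 => (fun x4 =>
        ih (tl U) (tl P) (tl (tl Q)) (tl S)
          (Nat.lor a1 x) (Nat.lor a2 (Nat.land a1 x)) (Nat.lor a3 (Nat.land a2 x))
          (Nat.lor a4 (Nat.land a3 x))
          (Nat.lor b1 x2) (Nat.lor b2 (Nat.land b1 x2)) (Nat.lor b3 (Nat.land b2 x2))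
          (Nat.lor c1 x3) (Nat.lor c2 (Nat.land c1 x3)) (Nat.lor d1 x4))
        (Nat.land x r4)) (Nat.land x r3)) (Nat.land x r2))
      (cut (cut (cut (cut r1 (hd U)) (hd Q)) (hd S)) (hd P))) R

/-- `P` is the reversed prefix of complements, `Q` the suffix from `b`, `S` the sums from
`2 * b`. -/
def ranks (U : NL) (G : NL) : NL → NL → NL → RL :=
  NL.rec (fun _ _ _ => RL.nil) (fun g _ ih P Q S =>
    (fun R => inner g R R U P (tl (tl Q)) (tl S) 0 0 0 0 0 0 0 0 0 0)
      (ih (cons (hd Q) P) (tl Q) (tl (tl S)))) G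

def sel (r : Nat) : Nat → Nat → Nat → Nat → Nat → Nat :=
  fun a b c d e => Nat.rec a (fun r _ => Nat.rec b (fun r _ => Nat.rec c
    (fun r _ => Nat.rec d (fun _ _ => e) r) r) r) r

def selR (r : Nat) (R : RL) : NL := RL.rec nil (fun a b c d e _ ih => cons (sel r a b c d e) ih) R

/-- Viable next elements, when `r + 1` elements of `[1, K]` remain to be added. -/
def viable (r K N : Nat) (M : NL) : NL :=
  (fun U => (fun S => (fun G => (fun m =>
      cons 0 (selR r (ranks (cpl m U) G (cons (Nat.xor m (hd M)) nil) (cpl m (tl M))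
        (cpl m (tl (tl S))))))
      (Nat.lor (hd M) (Nat.shiftLeft (hd M) 1)))
    (cands (hd M) (Nat.sub 4 r) U K (cons (hd M) nil) (tl M) (tl (tl S))
      (cons (hd M) (zeros 6))))
    (sums M (Nat.mul 2 (Nat.succ K)) nil M)) (diffs M N (tl M))

def blen (w : Nat) : Nat → Nat → Nat :=
  Nat.rec (fun _ acc => Nat.succ acc) (fun j ih A acc =>
    (fun s => Bool.rec (ih A acc) (ih (Nat.shiftRight A s) (Nat.add acc s))
      (Nat.ble (Nat.pow 2 s) A)) (Nat.pow 2 j)) w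

/-- Bit length. -/
def bl (A : Nat) : Nat := blen 23 A 0

/-- Prefix exclusive or. -/
def pxor (n : Nat) : Nat → Nat → Nat :=
  Nat.rec (fun m _ => m)
    (fun _ ih m s => ih (Nat.xor m (Nat.shiftLeft m s)) (Nat.shiftLeft s 1)) n

/-- Move the bits `mv` to the right by `s`, and keep the bits `A1`. -/
def moveRows (A1 mv s : Nat) (l : NL) : NL :=
  NL.rec nil (fun r _ ih =>
    cons (Nat.lor (Nat.land r A1) (Nat.shiftRight (Nat.land r mv) s)) ih) l

def comp (w full : Nat) (k : NL → NL → Bool) (j : Nat) : Nat → Nat → Nat → NL → NL → Bool :=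
  Nat.rec (fun _ _ _ X Y => k X Y)
  (fun _ ih s A mk X Y =>
    (fun mp => (fun mv => (fun A1 => (fun A2 =>
      Bool.rec false
       (Bool.rec false
         (ih (Nat.shiftLeft s 1) (Nat.lor A1 A2) (Nat.land mk (Nat.xor full mp))
           (moveRows A1 mv s X) (moveRows A1 mv s Y))
         (Nat.beq (Nat.land A1 A2) 0))
       (Nat.beq (Nat.shiftLeft A2 s) mv)) (Nat.shiftRight mv s)) (Nat.xor A mv))
      (Nat.land mp A)) (Nat.land (pxor w mk 1) full)) j

/-- Keep only the lanes in `A`, compressed to the right. -/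
def compress (A : Nat) (X Y : NL) (k : NL → NL → Bool) : Bool :=
  (fun n => (fun w => (fun full =>
    comp w full k w 1 A (Nat.land (Nat.shiftLeft (Nat.xor full A) 1) full) X Y)
   (Nat.sub (Nat.pow 2 n) 1)) (bl n)) (bl A)

/-- Concatenation of lanes. -/
def cat (X Y : NL) (k : NL → Bool) : Bool :=
  (fun n => Bool.rec false (k (zor X (shl n Y)))
    (Nat.beq (Nat.shiftRight (orAll X) n) 0)) (bl (hd X))

/-- The first element of each lane. -/
def firsts (V : NL) : Nat → NL := NL.rec (fun _ => nil)
  (fun v _ ih u => cons (Nat.xor v (Nat.land v u)) (ih (Nat.lor u v))) V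

/-- All but the first element of each lane. -/
def rest (V : NL) : Nat → NL := NL.rec (fun _ => nil)
  (fun v _ ih u => cons (Nat.land v u) (ih (Nat.lor u v))) V

/-- All extensions of the lanes of `M` by one of the corresponding elements of `V`. -/
def peel (k : NL → Bool) (n : Nat) : NL → NL → NL → Bool := Nat.rec (fun _ _ _ => false)
  (fun _ ih M V acc => Bool.rec
    (compress (orAll V) M V (fun M V =>
      cat acc (zor M (firsts V 0)) (fun acc => ih M (rest V 0) acc)))
    (k acc) (Nat.beq (orAll V) 0)) n

/-- The lanes contained in the set with binary code `q`. -/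
def agree (m0 : Nat) (M : NL) : Nat → Nat := NL.rec (fun _ => m0)
  (fun m _ ih q =>
    Nat.land (Bool.rec (Nat.xor m0 m) m (Nat.beq (Nat.mod q 2) 1)) (ih (Nat.div q 2))) M

/-- All lanes are described by the list of codes. -/
def fin (codes : NL) (M : NL) : Bool :=
  Nat.beq (hd M) (NL.rec 0 (fun q _ ih => Nat.lor (agree (hd M) M q) ih) codes)

/-- All extensions of the lanes by `r` elements are described by the list of codes. -/
def run (codes : NL) (K N : Nat) (r : Nat) : NL → Bool := Nat.rec (fun M => fin codes M)
  (fun r ih M => Bool.rec (peel ih 60 M (viable r K N M) nil) true (Nat.beq (hd M) 0)) r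

def genNext (l : TL) : Nat → NL → TL := TL.rec (fun _ _ => TL.nil)
  (fun n x _ ih pc pr =>
    TL.cons (Nat.add n pc) (cons (Nat.shiftLeft (Nat.sub (Nat.pow 2 pc) 1) n) (zor x (shl n pr)))
      (ih n x)) l

def gens (n : Nat) : TL → TL := Nat.rec (fun l => l) (fun _ ih l => ih (genNext l 0 nil)) n

def appT (l m : TL) : TL := TL.rec m (fun a b _ ih => TL.cons a b ih) l

def tab0 (k : Nat) : TL := TL.cons 1 nil (Nat.rec TL.nil (fun _ ih => TL.cons 0 nil ih) k)

def lastT (l : TL) : Nat → NL → (Nat → NL → Bool) → Bool :=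
  TL.rec (fun n x k => k n x) (fun n x _ ih _ _ k => ih n x k) l

/-- The lanes in which the two sets have at least two common elements. -/
def two (l : NL) : NL → Nat → Nat → Nat := NL.rec (fun _ _ b => b)
  (fun x _ ih ys a b => NL.rec b (fun y t _ =>
    (fun z => ih t (Nat.lor a z) (Nat.lor b (Nat.land a z))) (Nat.land x y)) ys) l

/-- The lanes in which some difference occurs twice. -/
def bad (X : NL) (n : Nat) : NL → Nat :=
  Nat.rec (fun _ => 0) (fun _ ih D => Nat.lor (two X D 0 0) (ih (tl D))) n

/-- Append to `acc` the sets `0, p + X, p + 1 + X, …`, where `p - 1` is the length of `pad`. -/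
def spread (X : NL) (k : NL → Bool) (n : Nat) : NL → NL → Bool := Nat.rec (fun acc _ => k acc)
  (fun _ ih acc pad =>
    cat acc (cons (hd X) (app pad X)) (fun acc => ih acc (cons 0 pad))) n

/-- The Sidon sets consisting of `0`, `t` and five elements in between, at least `v0`, with the
smallest one below `v1`. -/
def tabl (t v0 v1 : Nat) (k : NL → Bool) : Bool :=
  lastT (gens (Nat.sub v1 v0) (appT (gens (Nat.sub t v1) (tab0 4)) (TL.cons 0 nil TL.nil))) 0 nil
    (fun c x => (fun m => (fun X =>
        compress (Nat.xor m (bad X t (tl X))) X nil (fun X _ => k X))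
      (zor (cons m (app (zeros (Nat.pred v0)) x)) (app (zeros t) (cons m nil))))
    (Nat.sub (Nat.pow 2 c) 1))

/-- The smallest length to be considered for the seventh mark `t`. -/
def minLen (t : Nat) : Nat :=
  Bool.rec 97 (Nat.succ (Nat.mul 2 t)) (Nat.ble 97 (Nat.succ (Nat.mul 2 t)))

def gather (K : Nat) (k : NL → Bool) (l : SL) : NL → Bool := SL.rec k (fun t v0 v1 _ ih acc =>
  Bool.rec false
    (tabl t v0 v1 (fun X => spread (revN (Nat.succ t) X nil) ih (Nat.sub 111 (minLen t)) acc
      (zeros (Nat.pred (Nat.sub (minLen t) t)))))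
    (Nat.ble 109 (Nat.add K t))) l

def block (codes : NL) (K : Nat) (l : SL) : Bool := gather K (run codes K 110 5) l nil

end Golomb

end

namespace Golomb

open NL

/-! ### Bit matrices -/

/-- `p` belongs to the set in lane `i`. -/
def has : NL → ℕ → ℕ → Prop
  | nil, _, _ => False
  | cons x _, 0, i => x.testBit i = true
  | cons _ l, p + 1, i => has l p i

@[simp] theorem has_nil (p i : ℕ) : has nil p i ↔ False := Iff.rfl

@[simp] theorem has_cons_zero (x : ℕ) (l : NL) (i : ℕ) :
    has (cons x l) 0 i ↔ x.testBit i = true := Iff.rfl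

@[simp] theorem has_cons_succ (x : ℕ) (l : NL) (p i : ℕ) :
    has (cons x l) (p + 1) i ↔ has l p i := Iff.rfl

@[simp] theorem has_tl (l : NL) (p i : ℕ) : has (tl l) p i ↔ has l (p + 1) i := by
  cases l <;> exact Iff.rfl

theorem testBit_hd (l : NL) (i : ℕ) : (hd l).testBit i = true ↔ has l 0 i := by
  cases l
  · simp [hd]
  · exact Iff.rfl

theorem natXor (a b : ℕ) : Nat.xor a b = a ^^^ b := rfl

theorem boolRec {α : Type*} (f t : α) (b : Bool) :
    (Bool.rec f t b : α) = if b = true then t else f := by cases b <;> rfl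

@[simp] theorem testBit_lor (a b i : ℕ) :
    (Nat.lor a b).testBit i = true ↔ a.testBit i = true ∨ b.testBit i = true := by
  simp

@[simp] theorem testBit_land (a b i : ℕ) :
    (Nat.land a b).testBit i = true ↔ a.testBit i = true ∧ b.testBit i = true := by
  simp

theorem testBit_xor (a b i : ℕ) :
    (Nat.xor a b).testBit i = true ↔ ¬ (a.testBit i = true ↔ b.testBit i = true) := by
  rw [natXor, Nat.testBit_xor]
  cases a.testBit i <;> cases b.testBit i <;> simp

@[simp] theorem testBit_shl (a s i : ℕ) :
    (Nat.shiftLeft a s).testBit i = true ↔ s ≤ i ∧ a.testBit (i - s) = true := by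
  simp [Nat.testBit_shiftLeft]

@[simp] theorem testBit_shr (a s i : ℕ) :
    (Nat.shiftRight a s).testBit i = true ↔ a.testBit (i + s) = true := by
  simp [Nat.testBit_shiftRight, Nat.add_comm]

theorem testBit_ones (n i : ℕ) : (Nat.sub (Nat.pow 2 n) 1).testBit i = true ↔ i < n := by
  have := Nat.testBit_two_pow_sub_one n i
  change (2 ^ n - 1).testBit i = true ↔ _
  simp [this]

theorem has_app_zeros (n : ℕ) (l : NL) (p i : ℕ) :
    has (app (zeros n) l) p i ↔ n ≤ p ∧ has l (p - n) i := by
  induction n generalizing p with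
  | zero => simp [zeros, app]
  | succ n ih =>
    change has (cons 0 (app (zeros n) l)) p i ↔ _
    cases p with
    | zero => simp
    | succ p => simp [ih]

theorem has_revN (n : ℕ) (l a : NL) (p i : ℕ) :
    has (revN n l a) p i ↔ (p < n ∧ has l (n - 1 - p) i) ∨ (n ≤ p ∧ has a (p - n) i) := by
  induction n generalizing l a p with
  | zero => simp [revN]
  | succ n ih =>
    change has (revN n (tl l) (cons (hd l) a)) p i ↔ _
    rw [ih]
    rcases lt_trichotomy p n with h | rfl | h
    · have h1 : n - 1 - p + 1 = n - p := by omega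
      simp [h, h1, h.not_ge, show p < n + 1 by omega, show ¬ n + 1 ≤ p by omega]
    · simp [testBit_hd]
    · obtain ⟨d, rfl⟩ : ∃ d, p = n + 1 + d := ⟨p - n - 1, by omega⟩
      have h1 : n + 1 + d - n = d + 1 := by omega
      simp [h1, show ¬ n + 1 + d < n by omega, show ¬ n + 1 + d ≤ n by omega,
        show n ≤ n + 1 + d by omega]

theorem testBit_orAll (l : NL) (i : ℕ) : (orAll l).testBit i = true ↔ ∃ p, has l p i := by
  induction l with
  | nil => simp [orAll]
  | cons x l ih =>
    change (Nat.lor x (orAll l)).testBit i = true ↔ _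
    rw [testBit_lor, ih]
    constructor
    · rintro (h | ⟨p, h⟩)
      · exact ⟨0, h⟩
      · exact ⟨p + 1, h⟩
    · rintro ⟨_ | p, h⟩
      · exact Or.inl h
      · exact Or.inr ⟨p, h⟩

@[simp] theorem has_zor (l m : NL) (p i : ℕ) : has (zor l m) p i ↔ has l p i ∨ has m p i := by
  induction l generalizing m p with
  | nil => simp [zor]
  | cons x l ih =>
    cases m with
    | nil => simp [zor]
    | cons y m =>
      change has (cons (Nat.lor x y) (zor l m)) p i ↔ _
      cases p <;> simp [ih]

@[simp] theorem has_shl (s : ℕ) (l : NL) (p i : ℕ) :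
    has (shl s l) p i ↔ s ≤ i ∧ has l p (i - s) := by
  induction l generalizing p with
  | nil => simp [shl]
  | cons x l ih =>
    change has (cons (Nat.shiftLeft x s) (shl s l)) p i ↔ _
    cases p <;> simp [ih]

theorem testBit_dot (l m : NL) (i : ℕ) :
    (dot l m).testBit i = true ↔ ∃ p, has l p i ∧ has m p i := by
  induction l generalizing m with
  | nil => simp [dot]
  | cons x l ih =>
    cases m with
    | nil => simp [dot]
    | cons y m =>
      have : (dot (cons x l) (cons y m)).testBit i = true ↔
          (Nat.lor (Nat.land x y) (dot l m)).testBit i = true := by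
        change (Nat.testBit (Bool.rec (Nat.lor (Nat.land x y) (dot l m)) (dot l m)
          (Nat.beq (Nat.land x y) 0) : ℕ) i = true) ↔ _
        rw [boolRec]
        split_ifs with h
        · rw [Nat.beq_eq] at h
          rw [h]
          simp
        · rfl
      rw [this, testBit_lor, testBit_land, ih]
      constructor
      · rintro (h | ⟨p, h⟩)
        · exact ⟨0, h⟩
        · exact ⟨p + 1, h⟩
      · rintro ⟨_ | p, h⟩
        · exact Or.inl h
        · exact Or.inr ⟨p, h⟩

theorem has_diffs (M D : NL) (n j i : ℕ) (h : has (diffs M n D) j i) :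
    ∃ p, has M p i ∧ has D (p + j) i := by
  induction n generalizing D j with
  | zero => simp [diffs] at h
  | succ n ih =>
    change has (cons (dot M D) (diffs M n (tl D))) j i at h
    cases j with
    | zero => simpa [testBit_dot] using h
    | succ j =>
      obtain ⟨p, h1, h2⟩ := ih _ _ h
      exact ⟨p, h1, by simpa [Nat.add_assoc] using h2⟩

/-- `P` lists the rows of `M` before row `s`, in reverse. -/
def Pre (M P : NL) (s i : ℕ) : Prop := ∀ x, has P x i → x + 1 ≤ s ∧ has M (s - 1 - x) i

/-- `Q` lists the rows of `M` from row `s`. -/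
def Suf (M Q : NL) (s i : ℕ) : Prop := ∀ x, has Q x i → has M (s + x) i

theorem Suf.tl {M Q : NL} {s i : ℕ} (h : Suf M Q s i) : Suf M (tl Q) (s + 1) i := by
  intro x hx
  have := h (x + 1) (by simpa using hx)
  rwa [show s + 1 + x = s + (x + 1) by omega]

theorem Pre.cons {M P Q : NL} {s i : ℕ} (h : Pre M P s i) (h' : Suf M Q s i) :
    Pre M (cons (hd Q) P) (s + 1) i := by
  rintro (_ | x) hx
  · refine ⟨by omega, ?_⟩
    simpa using h' 0 (by simpa [testBit_hd] using hx)
  · obtain ⟨h1, h2⟩ := h x hx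
    refine ⟨by omega, ?_⟩
    rwa [show s + 1 - 1 - (x + 1) = s - 1 - x by omega]

theorem has_sums (M P Q : NL) (n s j i : ℕ) (hP : Pre M P s i) (hQ : Suf M Q s i)
    (h : has (sums M n P Q) j i) : ∃ p q, has M p i ∧ has M q i ∧ p + q = s + j := by
  induction n generalizing P Q s j with
  | zero => simp [sums] at h
  | succ n ih =>
    change has (NL.cons (dot (NL.cons (hd Q) P) M) (sums M n (NL.cons (hd Q) P) (Golomb.tl Q))) j i at h
    cases j with
    | zero =>
      rw [has_cons_zero, testBit_dot] at h
      obtain ⟨p, h1, h2⟩ := h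
      obtain ⟨h3, h4⟩ := hP.cons hQ p h1
      exact ⟨_, _, h4, h2, by omega⟩
    | succ j =>
      obtain ⟨p, q, h1, h2, h3⟩ := ih _ _ (s + 1) j (hP.cons hQ) hQ.tl h
      exact ⟨p, q, h1, h2, by omega⟩

/-- Lane `i` of `M` is the set `B`, which contains `0`. -/
def Lane (M : NL) (i : ℕ) (B : Finset ℕ) : Prop := 0 ∈ B ∧ ∀ p, has M p i ↔ p ∈ B

/-- Sidon sets of natural numbers. -/
def Sid (Z : Finset ℕ) : Prop :=
  ∀ a ∈ Z, ∀ b ∈ Z, ∀ c ∈ Z, ∀ d ∈ Z, a + b = c + d → a = c ∨ a = d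

/-- The element `c` can be added to `B`. -/
def Fits (B : Finset ℕ) (c : ℕ) : Prop :=
  c ∉ B ∧ (∀ p ∈ B, ∀ q ∈ B, p + q ≠ 2 * c) ∧
    ∀ b ∈ B, ∀ p ∈ B, ∀ q ∈ B, c + p ≠ b + q

/-- The elements `b` and `c` can be added to `B` together. -/
def Compat (B : Finset ℕ) (b c : ℕ) : Prop :=
  (∀ p ∈ B, ∀ q ∈ B, c + p ≠ b + q) ∧ (∀ p ∈ B, c + p ≠ 2 * b) ∧
    (∀ q ∈ B, b + q ≠ 2 * c) ∧ ∀ p ∈ B, ∀ q ∈ B, p + q ≠ b + c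

theorem Sid.fits {B C : Finset ℕ} (h : Sid (B ∪ C)) {c : ℕ} (hc : c ∈ C) (hcB : c ∉ B) :
    Fits B c := by
  have hc' : c ∈ B ∪ C := Finset.mem_union_right _ hc
  have hB : ∀ p ∈ B, p ∈ B ∪ C := fun p => Finset.mem_union_left _
  refine ⟨hcB, fun p hp q hq e => ?_, fun b hb p hp q hq e => ?_⟩
  · rcases h p (hB p hp) q (hB q hq) c hc' c hc' (by omega) with rfl | rfl <;> exact hcB hp
  · rcases h c hc' p (hB p hp) b (hB b hb) q (hB q hq) e with rfl | rfl
    · exact hcB hb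
    · exact hcB hq

theorem Sid.compat {B C : Finset ℕ} (h : Sid (B ∪ C)) {b c : ℕ} (hb : b ∈ C) (hc : c ∈ C)
    (hbB : b ∉ B) (hcB : c ∉ B) (hbc : b ≠ c) : Compat B b c := by
  have hc' : c ∈ B ∪ C := Finset.mem_union_right _ hc
  have hb' : b ∈ B ∪ C := Finset.mem_union_right _ hb
  have hB : ∀ p ∈ B, p ∈ B ∪ C := fun p => Finset.mem_union_left _
  refine ⟨fun p hp q hq e => ?_, fun p hp e => ?_, fun p hp e => ?_, fun p hp q hq e => ?_⟩
  · rcases h c hc' p (hB p hp) b hb' q (hB q hq) e with rfl | rfl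
    · exact hbc rfl
    · exact hcB hq
  · rcases h c hc' p (hB p hp) b hb' b hb' (by omega) with rfl | rfl <;> exact hbc rfl
  · rcases h b hb' p (hB p hp) c hc' c hc' (by omega) with rfl | rfl <;> exact hbc rfl
  · rcases h p (hB p hp) q (hB q hq) b hb' c hc' e with rfl | rfl
    · exact hbB hp
    · exact hcB hp

/-! ### Elements that can be added -/

def len : NL → ℕ
  | nil => 0
  | cons _ l => len l + 1

theorem len_thr (T : NL) (p m : ℕ) : len (thr T p m) = len T := by
  induction T generalizing p with
  | nil => rfl
  | cons t T ih => exact congrArg (· + 1) (ih t)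

theorem not_has_zeros (n p i : ℕ) : ¬ has (zeros n) p i := by
  induction n generalizing p with
  | zero => exact id
  | succ n ih =>
    cases p with
    | zero => change ¬ (Nat.testBit 0 i = true); simp
    | succ p => exact ih p

theorem has_thr_zero (T : NL) (p m i : ℕ) (h : 0 < len T) :
    has (thr T p m) 0 i ↔ has T 0 i ∨ p.testBit i = true ∧ m.testBit i = true := by
  cases T with
  | nil => simp [len] at h
  | cons t T =>
    change (Nat.lor t (Nat.land p m)).testBit i = true ↔ _
    simp

theorem has_thr_succ (T : NL) (p m i j : ℕ) (h : j + 1 < len T) :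
    has (thr T p m) (j + 1) i ↔ has T (j + 1) i ∨ has T j i ∧ m.testBit i = true := by
  induction T generalizing p j with
  | nil => simp [len] at h
  | cons t T ih =>
    change has (thr T t m) j i ↔ _
    cases j with
    | zero => simpa using has_thr_zero T t m i (by simpa [len] using h)
    | succ j => simpa using ih t j (by simpa [len] using h)

theorem testBit_nth (n : ℕ) (l : NL) (i : ℕ) : (nth n l).testBit i = true ↔ has l n i := by
  induction n generalizing l with
  | zero => exact testBit_hd l i
  | succ n ih =>
    change (nth n (tl l)).testBit i = true ↔ _
    rw [ih, has_tl]

/-- The number of elements up to `c`. -/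
def cnt (B : Finset ℕ) (c : ℕ) : ℕ := (B.filter (· ≤ c)).card

theorem cnt_succ (B : Finset ℕ) (c : ℕ) :
    cnt B (c + 1) = cnt B c + if c + 1 ∈ B then 1 else 0 := by
  unfold cnt
  have : B.filter (· ≤ c + 1) = B.filter (· ≤ c) ∪ B.filter (· = c + 1) := by
    ext x
    simp only [Finset.mem_filter, Finset.mem_union]
    grind
  rw [this, Finset.card_union_of_disjoint]
  · congr 1
    split_ifs with h
    · rw [Finset.filter_eq', if_pos h, Finset.card_singleton]
    · rw [Finset.filter_eq', if_neg h, Finset.card_empty]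
  · rw [Finset.disjoint_filter]
    intro x _ h
    omega

theorem has_cands {M U : NL} {i : ℕ} {B : Finset ℕ} (hM : Lane M i B)
    (hU : ∀ x, has U x i → ∃ p, has M p i ∧ has M (p + x + 1) i) {k : ℕ} (hk : k ≤ 5)
    (K : ℕ) (P Q S T : NL) (c : ℕ) (hP : Pre M P (c + 1) i)
    (hQ : ∀ x, has Q x i ↔ has M (c + 1 + x) i)
    (hS : ∀ x, has S x i → ∃ p q, has M p i ∧ has M q i ∧ p + q = 2 * (c + 1) + x)
    (hT : len T = 7) (hTc : ∀ j < 7, has T j i ↔ j + 1 ≤ cnt B c) (j : ℕ) (hj : j < K)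
    (hf : Fits B (c + 1 + j)) (hc : cnt B (c + 1 + j) = k + 1) :
    has (cands (hd M) k U K P Q S T) j i := by
  induction K generalizing P Q S T c j with
  | zero => omega
  | succ K ih =>
    have h0 : (hd M).testBit i = true := (testBit_hd M i).2 ((hM.2 0).2 hM.1)
    have hT' : ∀ j < 7, has (thr T (hd M) (hd Q)) j i ↔ j + 1 ≤ cnt B (c + 1) := by
      intro j hj
      have hQ0 : (hd Q).testBit i = true ↔ c + 1 ∈ B := by
        rw [testBit_hd, hQ 0, hM.2]
      rw [cnt_succ]
      cases j with
      | zero =>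
        rw [has_thr_zero _ _ _ _ (by omega), hQ0, hTc 0 hj]
        simp only [h0, true_and]
        split_ifs <;> simp [*]
      | succ j =>
        rw [has_thr_succ _ _ _ _ _ (by omega), hQ0, hTc _ hj, hTc j (by omega)]
        split_ifs with h <;> simp only [h, and_true, and_false, or_false] <;> omega
    cases j with
    | zero =>
      change (Nat.land (nth k (thr T (hd M) (hd Q))) (Nat.xor (hd M)
        (Nat.lor (Nat.lor (nth (Nat.succ k) (thr T (hd M) (hd Q))) (hd Q))
        (Nat.lor (hd S) (Nat.lor (dot P U) (dot (tl Q) U)))))).testBit i = true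
      rw [testBit_land, testBit_xor, testBit_nth, hT' k (by omega)]
      refine ⟨le_of_eq hc.symm, fun h => ?_⟩
      have h1 := h.1 h0
      simp only [testBit_lor, testBit_nth, testBit_hd, testBit_dot] at h1
      rw [hT' _ (by omega)] at h1
      obtain ⟨hf1, hf2, hf3⟩ := hf
      simp only [hM.2] at *
      rcases h1 with (h1 | h1) | h1 | ⟨x, h1, h2⟩ | ⟨x, h1, h2⟩
      · simp only [Nat.add_zero] at hc; omega
      · exact hf1 ((hQ 0).1 h1)
      · obtain ⟨p, q, hp, hq, e⟩ := hS 0 h1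
        exact hf2 p hp q hq e
      · obtain ⟨h3, h4⟩ := hP x h1
        obtain ⟨p, h5, h6⟩ := hU x h2
        exact hf3 _ ((hM.2 _).1 h4) p h5 _ h6 (by omega)
      · rw [has_tl, hQ] at h1
        obtain ⟨p, h5, h6⟩ := hU x h2
        exact hf3 p h5 _ h6 _ h1 (by omega)
    | succ j =>
      change has (cands (hd M) k U K (NL.cons (hd Q) P) (tl Q) (tl (tl S))
        (thr T (hd M) (hd Q))) j i
      refine ih _ _ _ _ (c + 1) ?_ ?_ ?_ (by rw [len_thr, hT]) hT' j (by omega) ?_ ?_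
      · exact hP.cons fun x hx => (hQ x).1 hx
      · intro x
        rw [has_tl, hQ, show c + 1 + (x + 1) = c + 1 + 1 + x by omega]
      · intro x hx
        rw [has_tl, has_tl] at hx
        obtain ⟨p, q, hp, hq, e⟩ := hS _ hx
        exact ⟨p, q, hp, hq, by omega⟩
      · rwa [show c + 1 + 1 + j = c + 1 + (j + 1) by omega]
      · rwa [show c + 1 + 1 + j = c + 1 + (j + 1) by omega]

/-- Row `x` contains lane `i`, where `0` stands for everything. -/
def Ok : NL → ℕ → ℕ → Prop
  | nil, _, _ => True
  | cons y _, 0, i => y = 0 ∨ y.testBit i = true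
  | cons _ l, x + 1, i => Ok l x i

@[simp] theorem ok_tl (l : NL) (x i : ℕ) : Ok (tl l) x i ↔ Ok l (x + 1) i := by
  cases l <;> exact Iff.rfl

theorem ok_hd (l : NL) (i : ℕ) : hd l = 0 ∨ (hd l).testBit i = true ↔ Ok l 0 i := by
  cases l
  · simp [hd, Ok]
  · exact Iff.rfl

theorem ok_cpl {m i : ℕ} (hm : m.testBit i = true) (l : NL) (x : ℕ) (h : ¬ has l x i) :
    Ok (cpl m l) x i := by
  induction l generalizing x with
  | nil => trivial
  | cons y l ih =>
    cases x with
    | zero =>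
      change (Bool.rec (Nat.xor m y) 0 (Nat.beq y 0) : ℕ) = 0 ∨
        Nat.testBit (Bool.rec (Nat.xor m y) 0 (Nat.beq y 0) : ℕ) i = true
      rw [boolRec]
      split_ifs
      · exact Or.inl rfl
      · right
        rw [testBit_xor]
        rw [has_cons_zero] at h
        tauto
    | succ x => exact ih x h

theorem testBit_cut {x n i : ℕ} (hx : x.testBit i = true) (hn : n = 0 ∨ n.testBit i = true) :
    (cut x n).testBit i = true := by
  change Nat.testBit (Bool.rec (Nat.land x n) x (Nat.beq n 0) : ℕ) i = true
  rw [boolRec]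
  split_ifs with h
  · exact hx
  · rw [Nat.beq_eq] at h
    rw [testBit_land]
    exact ⟨hx, hn.resolve_left h⟩

/-- The number of elements above `b`. -/
def above (C : Finset ℕ) (b : ℕ) : ℕ := (C.filter (b < ·)).card

theorem above_of_mem {C : Finset ℕ} {s : ℕ} (h : s + 1 ∈ C) : above C s = above C (s + 1) + 1 := by
  unfold above
  rw [← Finset.card_insert_of_notMem (a := s + 1) (by simp)]
  congr 1
  ext x
  simp only [Finset.mem_filter, Finset.mem_insert]
  grind

theorem above_of_notMem {C : Finset ℕ} {s : ℕ} (h : s + 1 ∉ C) : above C s = above C (s + 1) := by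
  unfold above
  congr 1
  ext x
  simp only [Finset.mem_filter]
  grind

theorem above_eq_zero {C : Finset ℕ} {s : ℕ} (h : ∀ c ∈ C, c < s + 1) : above C s = 0 := by
  unfold above
  rw [Finset.card_eq_zero, Finset.filter_eq_empty_iff]
  intro x hx
  have := h x hx
  omega

def RankBits (i k r1 r2 r3 r4 r5 : ℕ) : Prop :=
  r1.testBit i = true ∧ (1 ≤ k → r2.testBit i = true) ∧ (2 ≤ k → r3.testBit i = true) ∧
    (3 ≤ k → r4.testBit i = true) ∧ (4 ≤ k → r5.testBit i = true)

/-- `R` is compatible with the solution `C` in lane `i`, from element `s` on. -/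
def ROk (i : ℕ) (C : Finset ℕ) : ℕ → RL → Prop
  | s, RL.nil => ∀ c ∈ C, c < s
  | s, RL.cons r1 r2 r3 r4 r5 R =>
    (s ∈ C → RankBits i (above C s) r1 r2 r3 r4 r5) ∧ ROk i C (s + 1) R

theorem inner_eq (g : ℕ) (R0 R : RL) (U P Q S : NL) (a1 a2 a3 a4 b1 b2 b3 c1 c2 d1 : ℕ) :
    ∃ r1 r2 r3 r4 r5, inner g R0 R U P Q S a1 a2 a3 a4 b1 b2 b3 c1 c2 d1 =
      RL.cons r1 r2 r3 r4 r5 R0 := by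
  induction R generalizing U P Q S a1 a2 a3 a4 b1 b2 b3 c1 c2 d1 with
  | nil => exact ⟨_, _, _, _, _, rfl⟩
  | cons r1 r2 r3 r4 r5 R ih => exact ih ..

theorem lor_of_carry {i v w k q q' l m : ℕ} {p : Prop} (hq : q = q' ∨ q = q' + 1 ∧ p)
    (hv : m + q ≤ k → m + l ≤ k → v.testBit i = true)
    (hw : p → m + q' = k ∧ q = q' + 1 → l ≤ q' → w.testBit i = true)
    (h : m + q' ≤ k) (h' : m + l ≤ k) : (Nat.lor v w).testBit i = true := by
  rw [testBit_lor]
  rcases hq with rfl | ⟨rfl, hp⟩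
  · exact Or.inl (hv h h')
  · by_cases h2 : m + (q' + 1) ≤ k
    · exact Or.inl (hv h2 h')
    · exact Or.inr (hw hp ⟨by omega, rfl⟩ (by omega))

theorem inner_rankBits {B C : Finset ℕ} {i b g : ℕ} (hg : g.testBit i = true)
    (hC : ∀ c ∈ C, c ≠ b → Compat B b c) (R0 R : RL) (U P Q S : NL)
    (a1 a2 a3 a4 b1 b2 b3 c1 c2 d1 s : ℕ) (hs : b ≤ s)
    (hU : ∀ x, (∀ p ∈ B, p + (s + 1 - b) + x ∉ B) → Ok U x i)
    (hP : ∀ x, (s + 1 + x ≤ 2 * b → 2 * b - (s + 1) - x ∉ B) → Ok P x i)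
    (hQ : ∀ x, 2 * (s + 1) - b + x ∉ B → Ok Q x i)
    (hS : ∀ x, (∀ p ∈ B, ∀ q ∈ B, p + q ≠ b + (s + 1) + x) → Ok S x i)
    (hR : ROk i C (s + 1) R)
    (ha1 : 1 + above C s ≤ above C b → a1.testBit i = true)
    (ha2 : 2 + above C s ≤ above C b → a2.testBit i = true)
    (ha3 : 3 + above C s ≤ above C b → a3.testBit i = true)
    (ha4 : 4 + above C s ≤ above C b → a4.testBit i = true)
    (hb1 : 1 + above C s ≤ above C b → 2 ≤ above C b → b1.testBit i = true)
    (hb2 : 2 + above C s ≤ above C b → 3 ≤ above C b → b2.testBit i = true)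
    (hb3 : 3 + above C s ≤ above C b → 4 ≤ above C b → b3.testBit i = true)
    (hc1 : 1 + above C s ≤ above C b → 3 ≤ above C b → c1.testBit i = true)
    (hc2 : 2 + above C s ≤ above C b → 4 ≤ above C b → c2.testBit i = true)
    (hd1 : 1 + above C s ≤ above C b → 4 ≤ above C b → d1.testBit i = true) :
    ∃ r1 r2 r3 r4 r5, inner g R0 R U P Q S a1 a2 a3 a4 b1 b2 b3 c1 c2 d1 =
      RL.cons r1 r2 r3 r4 r5 R0 ∧ RankBits i (above C b) r1 r2 r3 r4 r5 := by
  induction R generalizing U P Q S a1 a2 a3 a4 b1 b2 b3 c1 c2 d1 s with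
  | nil =>
    refine ⟨_, _, _, _, _, rfl, ?_⟩
    rw [above_eq_zero hR] at *
    simp only [RankBits, testBit_land, hg, true_and]
    exact ⟨fun h => ha1 (by omega), fun h => ⟨ha2 (by omega), hb1 (by omega) (by omega)⟩,
      fun h => ⟨ha3 (by omega), hb2 (by omega) (by omega), hc1 (by omega) (by omega)⟩,
      fun h => ⟨ha4 (by omega), hb3 (by omega) (by omega), hc2 (by omega) (by omega),
        hd1 (by omega) (by omega)⟩⟩
  | cons r1 r2 r3 r4 r5 R ih =>
    have hq : above C s = above C (s + 1) ∨
        above C s = above C (s + 1) + 1 ∧ s + 1 ∈ C := by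
      by_cases hm : s + 1 ∈ C
      · exact Or.inr ⟨above_of_mem hm, hm⟩
      · exact Or.inl (above_of_notMem hm)
    have hx : s + 1 ∈ C →
        (cut (cut (cut (cut r1 (hd U)) (hd Q)) (hd S)) (hd P)).testBit i = true := by
      intro hm
      obtain ⟨k1, k2, k3, k4⟩ := hC _ hm (by omega)
      refine testBit_cut (testBit_cut (testBit_cut (testBit_cut (hR.1 hm).1 ?_) ?_) ?_) ?_ <;>
        rw [ok_hd]
      · exact hU 0 fun p hp hq => k1 p hp _ hq (by omega)
      · exact hQ 0 fun hq => k3 _ hq (by omega)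
      · exact hS 0 fun p hp q hq e => k4 p hp q hq (by omega)
      · exact hP 0 fun h hp => k2 _ hp (by omega)
    have hx2 := fun (hm : s + 1 ∈ C) (h : 1 ≤ above C (s + 1)) =>
      (testBit_land _ _ i).2 ⟨hx hm, (hR.1 hm).2.1 h⟩
    have hx3 := fun (hm : s + 1 ∈ C) (h : 2 ≤ above C (s + 1)) =>
      (testBit_land _ _ i).2 ⟨hx hm, (hR.1 hm).2.2.1 h⟩
    have hx4 := fun (hm : s + 1 ∈ C) (h : 3 ≤ above C (s + 1)) =>
      (testBit_land _ _ i).2 ⟨hx hm, (hR.1 hm).2.2.2.1 h⟩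
    refine ih (tl U) (tl P) (tl (tl Q)) (tl S) _ _ _ _ _ _ _ _ _ _ (s + 1) (by omega)
      ?_ ?_ ?_ ?_ hR.2 ?_ ?_ ?_ ?_ ?_ ?_ ?_ ?_ ?_ ?_
    · intro x hx
      rw [ok_tl]
      refine hU _ fun p hp => ?_
      have := hx p hp
      rwa [show p + (s + 1 + 1 - b) + x = p + (s + 1 - b) + (x + 1) by omega] at this
    · intro x hx
      rw [ok_tl]
      refine hP _ fun h => ?_
      have := hx (by omega)
      rwa [show 2 * b - (s + 1 + 1) - x = 2 * b - (s + 1) - (x + 1) by omega] at this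
    · intro x hx
      rw [ok_tl, ok_tl]
      refine hQ _ ?_
      rwa [show 2 * (s + 1 + 1) - b + x = 2 * (s + 1) - b + (x + 1 + 1) by omega] at hx
    · intro x hx
      rw [ok_tl]
      refine hS _ fun p hp q hq => ?_
      have := hx p hp q hq
      omega
    all_goals clear ih hU hP hQ hS hC hs
    · exact fun h => lor_of_carry hq (fun h _ => ha1 h) (fun hm _ _ => hx hm) h (l := 0) (by omega)
    · exact fun h => lor_of_carry hq (fun h _ => ha2 h)
        (fun hm e _ => (testBit_land ..).2 ⟨ha1 (by omega), hx hm⟩) h (l := 0) (by omega)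
    · exact fun h => lor_of_carry hq (fun h _ => ha3 h)
        (fun hm e _ => (testBit_land ..).2 ⟨ha2 (by omega), hx hm⟩) h (l := 0) (by omega)
    · exact fun h => lor_of_carry hq (fun h _ => ha4 h)
        (fun hm e _ => (testBit_land ..).2 ⟨ha3 (by omega), hx hm⟩) h (l := 0) (by omega)
    · exact lor_of_carry (l := 1) hq hb1 fun hm e _ => hx2 hm (by omega)
    · exact lor_of_carry (l := 1) hq hb2 fun hm e _ =>
        (testBit_land ..).2 ⟨hb1 (by omega) (by omega), hx2 hm (by omega)⟩
    · exact lor_of_carry (l := 1) hq hb3 fun hm e _ =>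
        (testBit_land ..).2 ⟨hb2 (by omega) (by omega), hx2 hm (by omega)⟩
    · exact lor_of_carry (l := 2) hq hc1 fun hm e _ => hx3 hm (by omega)
    · exact lor_of_carry (l := 2) hq hc2 fun hm e _ =>
        (testBit_land ..).2 ⟨hc1 (by omega) (by omega), hx3 hm (by omega)⟩
    · exact lor_of_carry (l := 3) hq hd1 fun hm e _ => hx4 hm (by omega)

theorem rOk_ranks {B C : Finset ℕ} {i : ℕ} (hC : ∀ b ∈ C, ∀ c ∈ C, c ≠ b → Compat B b c)
    (U G P Q S : NL) (b : ℕ)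
    (hU : ∀ x, (∀ p ∈ B, p + 1 + x ∉ B) → Ok U x i)
    (hG : ∀ c ∈ C, b ≤ c → has G (c - b) i)
    (hP : ∀ x, (x + 1 ≤ b → b - 1 - x ∉ B) → Ok P x i)
    (hQ : ∀ x, b + x ∉ B → Ok Q x i)
    (hS : ∀ x, (∀ p ∈ B, ∀ q ∈ B, p + q ≠ 2 * b + x) → Ok S x i) :
    ROk i C b (ranks U G P Q S) := by
  induction G generalizing P Q S b with
  | nil => exact fun c hc => not_le.1 fun h => hG c hc h
  | cons g G ih =>
    have hR : ROk i C (b + 1) (ranks U G (NL.cons (hd Q) P) (tl Q) (tl (tl S))) := by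
      refine ih _ _ _ (b + 1) ?_ ?_ ?_ ?_
      · intro c hc h
        have := hG c hc (by omega)
        rwa [show c - b = c - (b + 1) + 1 by omega] at this
      · rintro (_ | x) hx
        · exact (ok_hd Q i).2 (hQ 0 (by simpa using hx))
        · refine hP x fun h => ?_
          have := hx (by omega)
          rwa [show b + 1 - 1 - (x + 1) = b - 1 - x by omega] at this
      · intro x hx
        rw [ok_tl]
        exact hQ _ (by rwa [show b + (x + 1) = b + 1 + x by omega])
      · intro x hx
        rw [ok_tl, ok_tl]
        refine hS _ fun p hp q hq => ?_
        have := hx p hp q hq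
        omega
    change ROk i C b (inner g (ranks U G (NL.cons (hd Q) P) (tl Q) (tl (tl S)))
      (ranks U G (NL.cons (hd Q) P) (tl Q) (tl (tl S)))
      U P (tl (tl Q)) (tl S) 0 0 0 0 0 0 0 0 0 0)
    generalize ranks U G (NL.cons (hd Q) P) (tl Q) (tl (tl S)) = R at hR ⊢
    by_cases hb : b ∈ C
    · have hg : g.testBit i = true := by simpa using hG b hb le_rfl
      obtain ⟨r1, r2, r3, r4, r5, h1, h2⟩ := inner_rankBits (B := B) (C := C) hg (hC b hb) R R U P (tl (tl Q)) (tl S) 0 0 0 0 0 0 0 0 0 0 b le_rfl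
        (by simpa using hU)
        (fun x hx => hP x fun h => by
          have := hx (by omega)
          rwa [show 2 * b - (b + 1) - x = b - 1 - x by omega] at this)
        (fun x hx => by
          rw [ok_tl, ok_tl]
          exact hQ _ (by rwa [show 2 * (b + 1) - b + x = b + (x + 1 + 1) by omega] at hx))
        (fun x hx => by
          rw [ok_tl]
          refine hS _ fun p hp q hq => ?_
          have := hx p hp q hq
          omega)
        hR (by omega) (by omega) (by omega) (by omega) (by omega) (by omega) (by omega)
        (by omega) (by omega) (by omega)
      rw [h1]
      exact ⟨fun _ => h2, hR⟩
    · obtain ⟨r1, r2, r3, r4, r5, h1⟩ := inner_eq g R R U P (tl (tl Q)) (tl S) 0 0 0 0 0 0 0 0 0 0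
      rw [h1]
      exact ⟨fun h => absurd h hb, hR⟩

theorem has_selR {i : ℕ} {C : Finset ℕ} {r : ℕ} (hr : r ≤ 4) (R : RL) (s : ℕ)
    (hR : ROk i C s R) {c : ℕ} (hc : c ∈ C) (hs : s ≤ c) (hrc : r ≤ above C c) :
    has (selR r R) (c - s) i := by
  induction R generalizing s with
  | nil => exact absurd (hR c hc) (not_lt.2 hs)
  | cons r1 r2 r3 r4 r5 R ih =>
    change has (cons (sel r r1 r2 r3 r4 r5) (selR r R)) (c - s) i
    rcases hs.eq_or_lt with rfl | h
    · obtain ⟨h1, h2, h3, h4, h5⟩ := hR.1 hc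
      rw [Nat.sub_self, has_cons_zero]
      interval_cases r
      · exact h1
      · exact h2 hrc
      · exact h3 hrc
      · exact h4 hrc
      · exact h5 hrc
    · rw [show c - s = c - (s + 1) + 1 by omega, has_cons_succ]
      exact ih (s + 1) hR.2 h

theorem has_viable {M : NL} {i r K : ℕ} {B C : Finset ℕ} (N : ℕ) (hM : Lane M i B) (hr : r ≤ 4)
    (hK : ∀ c ∈ C, 1 ≤ c ∧ c ≤ K) (hcB : ∀ c ∈ C, c ∉ B)
    (hcnt : ∀ c ∈ C, cnt B c + (r + 1) = 6) (hsid : Sid (B ∪ C)) {c : ℕ} (hc : c ∈ C)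
    (hrc : r ≤ above C c) : has (viable r K N M) c i := by
  set U := diffs M N (tl M) with hUdef
  set S := sums M (Nat.mul 2 (Nat.succ K)) nil M with hSdef
  set G := cands (hd M) (Nat.sub 4 r) U K (cons (hd M) nil) (tl M) (tl (tl S))
    (cons (hd M) (zeros 6)) with hGdef
  set m := Nat.lor (hd M) (Nat.shiftLeft (hd M) 1) with hmdef
  change has (cons 0 (selR r (ranks (cpl m U) G (cons (Nat.xor m (hd M)) nil) (cpl m (tl M))
        (cpl m (tl (tl S)))))) c i
  have h0 : has M 0 i := (hM.2 0).2 hM.1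
  have hm : m.testBit i = true := by
    rw [hmdef, testBit_lor, testBit_hd]
    exact Or.inl h0
  have hU : ∀ x, has U x i → ∃ p, has M p i ∧ has M (p + x + 1) i := by
    intro x hx
    obtain ⟨p, h1, h2⟩ := has_diffs _ _ _ _ _ hx
    exact ⟨p, h1, by simpa using h2⟩
  have hS : ∀ x, has S x i → ∃ p q, has M p i ∧ has M q i ∧ p + q = x := by
    intro x hx
    obtain ⟨p, q, h1, h2, h3⟩ := has_sums M nil M _ 0 x i (fun x hx => hx.elim)
      (fun x hx => by simpa using hx) hx
    exact ⟨p, q, h1, h2, by omega⟩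
  have hG : ∀ c ∈ C, 1 ≤ c → has G (c - 1) i := by
    intro c hc h
    refine has_cands hM hU (show 4 - r ≤ 5 by omega) K _ _ _ _ 0 ?_ ?_ ?_ rfl ?_ (c - 1) ?_ ?_ ?_
    · rintro (_ | x) hx
      · simpa using h0
      · exact hx.elim
    · intro x
      rw [has_tl, show 0 + 1 + x = x + 1 by omega]
    · intro x hx
      obtain ⟨p, q, h1, h2, h3⟩ := hS (x + 1 + 1) (by simpa using hx)
      exact ⟨p, q, h1, h2, by omega⟩
    · have hc0 : cnt B 0 = 1 := by
        rw [cnt, Finset.card_eq_one]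
        refine ⟨0, ?_⟩
        ext x
        simp only [Finset.mem_filter, Finset.mem_singleton]
        constructor
        · rintro ⟨_, h⟩; omega
        · rintro rfl; exact ⟨hM.1, le_rfl⟩
      rw [hc0]
      rintro (_ | j) hj
      · simpa [testBit_hd] using h0
      · rw [has_cons_succ]
        exact iff_of_false (not_has_zeros 6 j i) (by omega)
    · have := (hK c hc).2
      omega
    · rw [show 0 + 1 + (c - 1) = c by omega]
      exact hsid.fits hc (hcB c hc)
    · rw [show 0 + 1 + (c - 1) = c by omega]
      have := hcnt c hc
      omega
  have hR : ROk i C 1 (ranks (cpl m U) G (cons (Nat.xor m (hd M)) nil) (cpl m (tl M))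
        (cpl m (tl (tl S)))) := by
    refine rOk_ranks (B := B) ?_ _ _ _ _ _ 1 ?_ hG ?_ ?_ ?_
    · intro b hb c hc hbc
      exact hsid.compat hb hc (hcB b hb) (hcB c hc) hbc.symm
    · intro x hx
      refine ok_cpl hm _ _ fun h => ?_
      obtain ⟨p, h1, h2⟩ := hU x h
      refine hx p ((hM.2 p).1 h1) ?_
      rw [show p + 1 + x = p + x + 1 by omega]
      exact (hM.2 _).1 h2
    · rintro (_ | x) hx
      · exact absurd hM.1 (by simpa using hx)
      · trivial
    · intro x hx
      refine ok_cpl hm _ _ fun h => hx ?_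
      rw [has_tl, hM.2] at h
      rwa [show 1 + x = x + 1 by omega]
    · intro x hx
      refine ok_cpl hm _ _ fun h => ?_
      obtain ⟨p, q, h1, h2, h3⟩ := hS (x + 1 + 1) (by simpa using h)
      exact hx p ((hM.2 p).1 h1) q ((hM.2 q).1 h2) (by omega)
  have h1 := (hK c hc).1
  rw [show c = c - 1 + 1 by omega, has_cons_succ]
  exact has_selR hr _ 1 hR hc h1 hrc

/-! ### Correctness of the search -/

theorem has_moveRows (A1 mv s : ℕ) (l : NL) (p i : ℕ) :
    has (moveRows A1 mv s l) p i ↔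
      (has l p i ∧ A1.testBit i = true) ∨ (has l p (i + s) ∧ mv.testBit (i + s) = true) := by
  induction l generalizing p with
  | nil => simp [moveRows]
  | cons r l ih =>
    change has (cons (Nat.lor (Nat.land r A1) (Nat.shiftRight (Nat.land r mv) s))
      (moveRows A1 mv s l)) p i ↔ _
    cases p with
    | zero => simp only [has_cons_zero, testBit_lor, testBit_land, testBit_shr]
    | succ p => simp [ih]

theorem exists_of_comp {w full : ℕ} {k : NL → NL → Bool} {j s A mk : ℕ} {X Y : NL}
    (h : comp w full k j s A mk X Y = true) :
    ∃ X' Y', k X' Y' = true ∧ ∀ i, A.testBit i = true →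
      ∃ i', ∀ p, (has X' p i' ↔ has X p i) ∧ (has Y' p i' ↔ has Y p i) := by
  induction j generalizing s A mk X Y with
  | zero => exact ⟨X, Y, h, fun i _ => ⟨i, fun p => ⟨Iff.rfl, Iff.rfl⟩⟩⟩
  | succ j ih =>
    have h' : ∃ mp mk', (Bool.rec false
       (Bool.rec false
         (comp w full k j (Nat.shiftLeft s 1)
           (Nat.lor (Nat.xor A (Nat.land mp A)) (Nat.shiftRight (Nat.land mp A) s)) mk'
           (moveRows (Nat.xor A (Nat.land mp A)) (Nat.land mp A) s X)
           (moveRows (Nat.xor A (Nat.land mp A)) (Nat.land mp A) s Y))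
         (Nat.beq (Nat.land (Nat.xor A (Nat.land mp A)) (Nat.shiftRight (Nat.land mp A) s)) 0))
       (Nat.beq (Nat.shiftLeft (Nat.shiftRight (Nat.land mp A) s) s) (Nat.land mp A))
        : Bool) = true := ⟨_, _, h⟩
    obtain ⟨mp, mk', h'⟩ := h'
    set mv := Nat.land mp A with hmv
    have hmvA : ∀ i, mv.testBit i = true → A.testBit i = true := by
      intro i hi
      rw [hmv, testBit_land] at hi
      exact hi.2
    rw [boolRec, boolRec] at h'
    split_ifs at h' with h1 h2
    rw [Nat.beq_eq] at h1 h2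
    obtain ⟨X', Y', hk, hXY⟩ := ih h'
    refine ⟨X', Y', hk, fun i hi => ?_⟩
    have hdisj : ∀ i, ¬ ((Nat.xor A mv).testBit i = true ∧ mv.testBit (i + s) = true) := by
      intro i hi
      rw [← testBit_shr, ← testBit_land, h2] at hi
      simp at hi
    have key : ∃ i₁, (Nat.lor (Nat.xor A mv) (Nat.shiftRight mv s)).testBit i₁ = true ∧
        ∀ Z p, has (moveRows (Nat.xor A mv) mv s Z) p i₁ ↔ has Z p i := by
      by_cases hm : mv.testBit i = true
      · have hsi : s ≤ i := by
          rw [← h1, testBit_shl] at hm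
          exact hm.1
        have hm' : mv.testBit (i - s + s) = true := by rwa [Nat.sub_add_cancel hsi]
        have := hdisj (i - s)
        refine ⟨i - s, ?_, fun Z p => ?_⟩
        · rw [testBit_lor, testBit_shr]
          exact Or.inr hm'
        · rw [has_moveRows, Nat.sub_add_cancel hsi]
          rw [Nat.sub_add_cancel hsi] at this
          tauto
      · have hx : (Nat.xor A mv).testBit i = true := by
          rw [testBit_xor]
          tauto
        have := hdisj i
        refine ⟨i, ?_, fun Z p => ?_⟩
        · rw [testBit_lor]
          exact Or.inl hx
        · rw [has_moveRows]
          tauto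
    obtain ⟨i₁, hi₁, hZ⟩ := key
    obtain ⟨i', hi'⟩ := hXY i₁ hi₁
    exact ⟨i', fun p => ⟨(hi' p).1.trans (hZ X p), (hi' p).2.trans (hZ Y p)⟩⟩

theorem exists_of_compress {A : ℕ} {X Y : NL} {k : NL → NL → Bool}
    (h : compress A X Y k = true) :
    ∃ X' Y', k X' Y' = true ∧ ∀ i, A.testBit i = true →
      ∃ i', ∀ p, (has X' p i' ↔ has X p i) ∧ (has Y' p i' ↔ has Y p i) := by
  delta compress at h
  generalize bl A = n at h
  simp only at h
  generalize bl n = w at h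
  exact exists_of_comp h

theorem exists_of_cat {X Y : NL} {k : NL → Bool} (h : cat X Y k = true) :
    ∃ Z, k Z = true ∧ (∀ i B, Lane X i B → Lane Z i B) ∧
      ∀ i B, Lane Y i B → ∃ j, Lane Z j B := by
  delta cat at h
  generalize bl (hd X) = n at h
  have h' : (Bool.rec false (k (zor X (shl n Y)))
    (Nat.beq (Nat.shiftRight (orAll X) n) 0) : Bool) = true := h
  rw [boolRec] at h'
  split_ifs at h' with h1
  rw [Nat.beq_eq] at h1
  have hlt : ∀ p i, has X p i → i < n := by
    intro p i hp
    by_contra hi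
    have : (Nat.shiftRight (orAll X) n).testBit (i - n) = true := by
      rw [testBit_shr, Nat.sub_add_cancel (not_lt.1 hi), testBit_orAll]
      exact ⟨p, hp⟩
    rw [h1] at this
    simp at this
  refine ⟨_, h', fun i B hB => ⟨hB.1, fun p => ?_⟩, fun i B hB => ⟨n + i, hB.1, fun p => ?_⟩⟩
  · rw [has_zor, has_shl, ← hB.2 p]
    have := hlt 0 i ((hB.2 0).2 hB.1)
    exact or_iff_left fun h => absurd h.1 (by omega)
  · rw [has_zor, has_shl, ← hB.2 p, Nat.add_sub_cancel_left]
    have : ¬ has X p (n + i) := fun h => absurd (hlt _ _ h) (by omega)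
    simp [this]

theorem has_firsts (V : NL) (u p i : ℕ) : has (firsts V u) p i ↔
    has V p i ∧ ¬ u.testBit i = true ∧ ∀ p' < p, ¬ has V p' i := by
  induction V generalizing u p with
  | nil => simp [firsts]
  | cons v V ih =>
    change has (cons (Nat.xor v (Nat.land v u)) (firsts V (Nat.lor u v))) p i ↔ _
    cases p with
    | zero =>
      simp only [has_cons_zero, testBit_xor, testBit_land, not_lt_zero, false_imp_iff,
        implies_true, and_true]
      tauto
    | succ p =>
      rw [has_cons_succ, ih, testBit_lor, has_cons_succ, Nat.forall_lt_succ_left]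
      simp only [has_cons_zero, has_cons_succ]
      tauto

theorem has_rest (V : NL) (u p i : ℕ) : has (rest V u) p i ↔
    has V p i ∧ (u.testBit i = true ∨ ∃ p' < p, has V p' i) := by
  induction V generalizing u p with
  | nil => simp [rest]
  | cons v V ih =>
    change has (cons (Nat.land v u) (rest V (Nat.lor u v))) p i ↔ _
    cases p with
    | zero => simp
    | succ p =>
      rw [has_cons_succ, ih, testBit_lor, has_cons_succ, Nat.exists_lt_succ_left]
      simp only [has_cons_zero, has_cons_succ]
      tauto

theorem exists_of_peel {k : NL → Bool} {n : ℕ} {M V acc : NL} (h : peel k n M V acc = true) :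
    ∃ acc', k acc' = true ∧ (∀ i B, Lane acc i B → ∃ j, Lane acc' j B) ∧
      ∀ i B a, Lane M i B → has V a i → ∃ j, Lane acc' j (insert a B) := by
  induction n generalizing M V acc with
  | zero => simp [peel] at h
  | succ n ih =>
    change (Bool.rec (compress (orAll V) M V (fun M V =>
      cat acc (zor M (firsts V 0)) (fun acc => peel k n M (rest V 0) acc)))
      (k acc) (Nat.beq (orAll V) 0) : Bool) = true at h
    rw [boolRec] at h
    split_ifs at h with h1
    · rw [Nat.beq_eq] at h1
      refine ⟨acc, h, fun i B hB => ⟨i, hB⟩, fun i B a _ ha => ?_⟩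
      have := (testBit_orAll V i).2 ⟨a, ha⟩
      rw [h1] at this
      simp at this
    · obtain ⟨M', V', h2, hMV⟩ := exists_of_compress h
      obtain ⟨acc₁, h3, hacc, hnew⟩ := exists_of_cat h2
      obtain ⟨acc₂, h4, hacc₂, hrest⟩ := ih h3
      refine ⟨acc₂, h4, fun i B hB => hacc₂ i B (hacc i B hB), fun i B a hM ha => ?_⟩
      obtain ⟨i', hi'⟩ := hMV i ((testBit_orAll V i).2 ⟨a, ha⟩)
      have hM' : Lane M' i' B := ⟨hM.1, fun p => (hi' p).1.trans (hM.2 p)⟩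
      have ha' : has V' a i' := (hi' a).2.2 ha
      by_cases hf : ∃ p' < a, has V' p' i'
      · exact hrest i' B a hM' ((has_rest ..).2 ⟨ha', Or.inr hf⟩)
      · have : Lane (zor M' (firsts V' 0)) i' (insert a B) := by
          refine ⟨Finset.mem_insert_of_mem hM.1, fun p => ?_⟩
          rw [has_zor, hM'.2, has_firsts, Finset.mem_insert, or_comm]
          refine or_congr_left ⟨fun ⟨hp, _, hp'⟩ => ?_, ?_⟩
          · rcases lt_trichotomy p a with h | h | h
            · exact absurd ⟨p, h, hp⟩ hf
            · exact h
            · exact absurd ha' (hp' a h)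
          · rintro rfl
            exact ⟨ha', by simp, fun p' h h' => hf ⟨p', h, h'⟩⟩
        obtain ⟨j, hj⟩ := hnew _ _ this
        exact hacc₂ j _ hj

theorem testBit_agree {m0 i : ℕ} (h0 : m0.testBit i = true) (M : NL) (q : ℕ)
    (h : (agree m0 M q).testBit i = true) (p : ℕ) (hp : has M p i) : q.testBit p = true := by
  induction M generalizing q p with
  | nil => exact hp.elim
  | cons m M ih =>
    change (Nat.land (Bool.rec (Nat.xor m0 m) m (Nat.beq (Nat.mod q 2) 1))
      (agree m0 M (Nat.div q 2))).testBit i = true at h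
    rw [testBit_land] at h
    cases p with
    | zero =>
      have h1 := h.1
      rw [boolRec] at h1
      split_ifs at h1 with h2
      · rw [Nat.beq_eq] at h2
        rw [Nat.testBit_zero]
        exact decide_eq_true h2
      · rw [testBit_xor] at h1
        exact absurd (iff_of_true h0 hp) h1
    | succ p =>
      rw [Nat.testBit_succ]
      exact ih (q / 2) h.2 p hp

/-- Membership in a list of numbers. -/
def NL.Mem (q : ℕ) : NL → Prop
  | nil => False
  | cons x l => q = x ∨ l.Mem q

theorem exists_of_fin {codes M : NL} (h : fin codes M = true) {i : ℕ} {B : Finset ℕ}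
    (hM : Lane M i B) : ∃ q, codes.Mem q ∧ ∀ p ∈ B, q.testBit p = true := by
  have h0 : (hd M).testBit i = true := (testBit_hd M i).2 ((hM.2 0).2 hM.1)
  have h1 : hd M = NL.rec 0 (fun q _ ih => Nat.lor (agree (hd M) M q) ih) codes :=
    Nat.eq_of_beq_eq_true h
  have h2 : (NL.rec 0 (fun q _ ih => Nat.lor (agree (hd M) M q) ih) codes : ℕ).testBit i
      = true := h1 ▸ h0
  clear h h1
  induction codes with
  | nil => simp at h2
  | cons q l ih =>
    rcases (testBit_lor ..).1 h2 with h | h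
    · exact ⟨q, Or.inl rfl, fun p hp => testBit_agree h0 M q h p ((hM.2 p).2 hp)⟩
    · obtain ⟨q', h3, h4⟩ := ih h
      exact ⟨q', Or.inr h3, h4⟩

theorem cnt_insert_of_lt {B : Finset ℕ} {c d : ℕ} (hc : c ∉ B) (h : c < d) :
    cnt (insert c B) d = cnt B d + 1 := by
  unfold cnt
  rw [Finset.filter_insert, if_pos h.le, Finset.card_insert_of_notMem]
  simp [hc]

theorem exists_of_run {codes : NL} {K N : ℕ} {r : ℕ} (hr : r ≤ 5) {M : NL}
    (h : run codes K N r M = true) {i : ℕ} {B C : Finset ℕ} (hM : Lane M i B)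
    (hCr : C.card = r) (hK : ∀ c ∈ C, 1 ≤ c ∧ c ≤ K) (hcB : ∀ c ∈ C, c ∉ B)
    (hcnt : ∀ c ∈ C, cnt B c + r = 6) (hsid : Sid (B ∪ C)) :
    ∃ q, codes.Mem q ∧ ∀ p ∈ B ∪ C, q.testBit p = true := by
  induction r generalizing M i B C with
  | zero =>
    rw [Finset.card_eq_zero] at hCr
    subst hCr
    simpa using exists_of_fin h hM
  | succ r ih =>
    change (Bool.rec (peel (run codes K N r) 60 M (viable r K N M) nil) true
      (Nat.beq (hd M) 0) : Bool) = true at h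
    have h0 : (hd M).testBit i = true := (testBit_hd M i).2 ((hM.2 0).2 hM.1)
    rw [boolRec, if_neg] at h
    · obtain ⟨acc, h1, -, h2⟩ := exists_of_peel h
      have hne : C.Nonempty := by
        rw [← Finset.card_pos]
        omega
      have hc := C.min'_mem hne
      set c := C.min' hne with hcdef
      have hlt : ∀ d ∈ C, d ≠ c → c < d := fun d hd hdc =>
        lt_of_le_of_ne (C.min'_le d hd) (Ne.symm hdc)
      have habove : above C c = r := by
        have : C.filter (c < ·) = C.erase c := by
          ext d
          simp only [Finset.mem_filter, Finset.mem_erase]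
          constructor
          · rintro ⟨h3, h4⟩
            exact ⟨by omega, h3⟩
          · rintro ⟨h3, h4⟩
            exact ⟨h4, hlt d h4 h3⟩
        rw [above, this, Finset.card_erase_of_mem hc, hCr]
        rfl
      obtain ⟨j, hj⟩ := h2 i B c hM
        (has_viable N hM (by omega) hK hcB hcnt hsid hc habove.ge)
      have hU : insert c B ∪ C.erase c = B ∪ C := by
        ext d
        simp only [Finset.mem_union, Finset.mem_insert, Finset.mem_erase]
        grind
      have := ih (by omega) h1 hj (C := C.erase c)
        (by rw [Finset.card_erase_of_mem hc, hCr]; rfl)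
        (fun d hd => hK d (Finset.mem_of_mem_erase hd))
        (fun d hd => by
          rw [Finset.mem_insert, not_or]
          exact ⟨Finset.ne_of_mem_erase hd, hcB d (Finset.mem_of_mem_erase hd)⟩)
        (fun d hd => by
          have hd' := Finset.mem_of_mem_erase hd
          rw [cnt_insert_of_lt (hcB c hc) (hlt d hd' (Finset.ne_of_mem_erase hd))]
          have := hcnt d hd'
          omega)
        (by rwa [hU])
      rwa [hU] at this
    · intro h1
      rw [Nat.beq_eq] at h1
      rw [h1] at h0
      simp at h0

/-! ### Starting sets -/

/-- The sets of `k` elements of `[p, t)`, with an element below `v` if `k = 5`. -/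
def Fam (v t p k : ℕ) (C : Finset ℕ) : Prop :=
  C.card = k ∧ (∀ c ∈ C, p ≤ c ∧ c < t) ∧ (k = 5 → ∃ c ∈ C, c < v)

/-- The `n` lanes of `x`, shifted by `p`, contain all sets with the property `F`. -/
def Lists (n : ℕ) (x : NL) (p : ℕ) (F : Finset ℕ → Prop) : Prop :=
  (∀ j i, has x j i → i < n) ∧ ∀ C, F C → ∃ i < n, ∀ j, has x j i ↔ p + j ∈ C

/-- `l` lists the families with `k`, `k + 1`, …, `e - 1` elements. -/
def Tables (v t p e : ℕ) : TL → ℕ → Prop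
  | TL.nil, k => k = e
  | TL.cons n x l, k => k ≤ 5 ∧ Lists n x p (Fam v t p k) ∧ Tables v t p e l (k + 1)

theorem Lists.next {n pc p : ℕ} {x pr : NL} {F G H : Finset ℕ → Prop}
    (hx : Lists n x (p + 1) F) (hpr : Lists pc pr (p + 1) G)
    (hF : ∀ C, H C → p ∉ C → F C) (hG : ∀ C, H C → p ∈ C → G (C.erase p)) :
    Lists (Nat.add n pc)
      (cons (Nat.shiftLeft (Nat.sub (Nat.pow 2 pc) 1) n) (zor x (shl n pr))) p H := by
  refine ⟨?_, fun C hC => ?_⟩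
  · rintro (_ | j) i h
    · rw [has_cons_zero, testBit_shl, testBit_ones] at h
      change i < n + pc
      omega
    · rw [has_cons_succ, has_zor, has_shl] at h
      change i < n + pc
      rcases h with h | ⟨h1, h⟩
      · have := hx.1 _ _ h
        omega
      · have := hpr.1 _ _ h
        omega
  · by_cases hpC : p ∈ C
    · obtain ⟨i, hi, h⟩ := hpr.2 _ (hG C hC hpC)
      refine ⟨n + i, Nat.add_lt_add_left hi n, ?_⟩
      rintro (_ | j)
      · rw [has_cons_zero, testBit_shl, testBit_ones, Nat.add_sub_cancel_left]
        simp [hi, hpC]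
      · have h1 : ¬ has x j (n + i) := fun h => absurd (hx.1 _ _ h) (by omega)
        rw [has_cons_succ, has_zor, has_shl, Nat.add_sub_cancel_left, h,
          show p + 1 + j = p + (j + 1) by omega]
        simp [h1]
    · obtain ⟨i, hi, h⟩ := hx.2 _ (hF C hC hpC)
      refine ⟨i, Nat.lt_add_right pc hi, ?_⟩
      rintro (_ | j)
      · rw [has_cons_zero, testBit_shl]
        exact iff_of_false (fun h => by omega) hpC
      · rw [has_cons_succ, has_zor, has_shl, h, show p + 1 + j = p + (j + 1) by omega]
        exact or_iff_left fun h => by omega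

theorem Tables.genNext {v t p e : ℕ} {l : TL} {k pc : ℕ} {pr : NL}
    (h : Tables v t (p + 1) e l k)
    (hpr : Lists pc pr (p + 1) fun C => Fam v t (p + 1) C.card C ∧ C.card + 1 = k) :
    Tables v t p e (genNext l pc pr) k := by
  induction l generalizing k pc pr with
  | nil => exact h
  | cons n x l ih =>
    obtain ⟨hk, hx, hl⟩ := h
    refine ⟨hk, hx.next hpr ?_ ?_, ih hl ?_⟩
    · rintro C ⟨h1, h2, h3⟩ hp
      refine ⟨h1, fun c hc => ⟨?_, (h2 c hc).2⟩, h3⟩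
      have : c ≠ p := fun h => hp (h ▸ hc)
      have := (h2 c hc).1
      omega
    · rintro C ⟨h1, h2, h3⟩ hp
      have hcard := Finset.card_erase_add_one hp
      refine ⟨⟨rfl, fun c hc => ?_, fun h => by omega⟩, by omega⟩
      obtain ⟨hc1, hc2⟩ := Finset.mem_erase.1 hc
      have := h2 c hc2
      omega
    · exact ⟨hx.1, fun C hC => hx.2 C (by
        obtain ⟨hC1, hC2⟩ := hC
        rwa [show C.card = k by omega] at hC1)⟩

theorem Tables.gens {v t p e n : ℕ} {l : TL} (h : Tables v t (p + n) e l 0) :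
    Tables v t p e (gens n l) 0 := by
  induction n generalizing l with
  | zero => exact h
  | succ n ih =>
    exact ih (l := Golomb.genNext l 0 nil)
      (h.genNext ⟨fun _ _ h => h.elim, fun C hC => absurd hC.2 (by omega)⟩)

theorem Tables.append {v t p e : ℕ} {l m : TL} {k : ℕ} (h : Tables v t p 5 l k)
    (hm : Tables v t p e m 5) : Tables v t p e (appT l m) k := by
  induction l generalizing k with
  | nil =>
    have : k = 5 := h
    subst this
    exact hm
  | cons n x l ih => exact ⟨h.1, h.2.1, ih h.2.2⟩

theorem lists_nil {p : ℕ} {F : Finset ℕ → Prop} (h : ∀ C, ¬ F C) : Lists 0 nil p F :=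
  ⟨fun _ _ h => h.elim, fun C hC => absurd hC (h C)⟩

theorem tables_tab0 (v t : ℕ) : Tables v t t 5 (tab0 4) 0 := by
  have h : ∀ k, 1 ≤ k → Lists 0 nil t (Fam v t t k) := by
    refine fun k hk => lists_nil ?_
    rintro C ⟨h1, h2, -⟩
    obtain ⟨c, hc⟩ := Finset.card_pos.1 (show 0 < C.card by omega)
    have := h2 c hc
    omega
  refine ⟨by omega, ⟨fun _ _ h => h.elim, ?_⟩, by omega, h _ (by omega), by omega, h _ (by omega),
    by omega, h _ (by omega), by omega, h _ (by omega), rfl⟩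
  rintro C ⟨h1, -, -⟩
  rw [Finset.card_eq_zero] at h1
  subst h1
  exact ⟨0, by omega, by simp⟩

theorem exists_of_lastT {v t p k n : ℕ} {l : TL} {x : NL} {f : ℕ → NL → Bool}
    (hl : Tables v t p 6 l (k + 1)) (hx : Lists n x p (Fam v t p k))
    (h : lastT l n x f = true) : ∃ n x, Lists n x p (Fam v t p 5) ∧ f n x = true := by
  induction l generalizing k n x with
  | nil =>
    have : k + 1 = 6 := hl
    obtain rfl : k = 5 := by omega
    exact ⟨n, x, hx, h⟩
  | cons m y l ih => exact ih hl.2.2 hl.2.1 h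

theorem testBit_two {l ys : NL} {a b i : ℕ} (h : (two l ys a b).testBit i = true) :
    b.testBit i = true ∨ (a.testBit i = true ∧ ∃ p, has l p i ∧ has ys p i) ∨
      ∃ p q, p < q ∧ has l p i ∧ has ys p i ∧ has l q i ∧ has ys q i := by
  induction l generalizing ys a b with
  | nil => exact Or.inl h
  | cons x l ih =>
    cases ys with
    | nil => exact Or.inl h
    | cons y ys =>
      change (two l ys (Nat.lor a (Nat.land x y))
        (Nat.lor b (Nat.land a (Nat.land x y)))).testBit i = true at h
      rcases ih h with h | ⟨h1, p, h2, h3⟩ | ⟨p, q, h1, h2⟩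
      · rw [testBit_lor, testBit_land, testBit_land] at h
        rcases h with h | ⟨h1, h2⟩
        · exact Or.inl h
        · exact Or.inr (Or.inl ⟨h1, 0, h2⟩)
      · rw [testBit_lor, testBit_land] at h1
        rcases h1 with h1 | h1
        · exact Or.inr (Or.inl ⟨h1, p + 1, h2, h3⟩)
        · exact Or.inr (Or.inr ⟨0, p + 1, by omega, h1.1, h1.2, h2, h3⟩)
      · exact Or.inr (Or.inr ⟨p + 1, q + 1, by omega, h2⟩)

theorem testBit_bad {X D : NL} {n i : ℕ} (h : (bad X n D).testBit i = true) :
    ∃ d p q, p < q ∧ has X p i ∧ has D (p + d) i ∧ has X q i ∧ has D (q + d) i := by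
  induction n generalizing D with
  | zero => simp [bad] at h
  | succ n ih =>
    change (Nat.lor (two X D 0 0) (bad X n (tl D))).testBit i = true at h
    rw [testBit_lor] at h
    rcases h with h | h
    · rcases testBit_two h with h | ⟨h, -⟩ | ⟨p, q, h1, h2⟩
      · simp at h
      · simp at h
      · exact ⟨0, p, q, h1, h2⟩
    · obtain ⟨d, p, q, h1, h2, h3, h4, h5⟩ := ih h
      rw [has_tl] at h3 h5
      exact ⟨d + 1, p, q, h1, h2, h3, h4, h5⟩

theorem exists_of_tabl {t v0 v1 : ℕ} {k : NL → Bool} (h : tabl t v0 v1 k = true)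
    (h0 : 1 ≤ v0) (h01 : v0 ≤ v1) (h1 : v1 ≤ t) :
    ∃ X, k X = true ∧ ∀ C, Fam v1 t v0 5 C → Sid (insert 0 (insert t C)) →
      ∃ i, Lane X i (insert 0 (insert t C)) := by
  have hT : Tables v1 t v0 6 (gens (Nat.sub v1 v0)
      (appT (gens (Nat.sub t v1) (tab0 4)) (TL.cons 0 nil TL.nil))) 0 := by
    refine Tables.gens ?_
    change Tables v1 t (v0 + (v1 - v0)) 6 _ 0
    rw [Nat.add_sub_cancel' h01]
    refine Tables.append (Tables.gens ?_) ⟨le_rfl, lists_nil ?_, rfl⟩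
    · change Tables v1 t (v1 + (t - v1)) 5 _ 0
      rw [Nat.add_sub_cancel' h1]
      exact tables_tab0 v1 t
    · rintro C ⟨-, h2, h3⟩
      obtain ⟨c, hc, hcv⟩ := h3 rfl
      have := (h2 c hc).1
      omega
  delta tabl at h
  generalize gens (Nat.sub v1 v0)
      (appT (gens (Nat.sub t v1) (tab0 4)) (TL.cons 0 nil TL.nil)) = l at hT h
  cases l with
  | nil => exact absurd (show 0 = 6 from hT) (by omega)
  | cons n x l =>
    obtain ⟨c, x, hx, hk⟩ := exists_of_lastT hT.2.2 hT.2.1 h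
    set m := Nat.sub (Nat.pow 2 c) 1 with hm
    have hk' := exists_of_compress hk
    set X := zor (cons m (app (zeros (Nat.pred v0)) x)) (app (zeros t) (cons m nil)) with hX
    obtain ⟨X', _, hX', hlane⟩ := hk'
    refine ⟨X', hX', fun C hC hsid => ?_⟩
    obtain ⟨i, hi, hiC⟩ := hx.2 C hC
    have hmi : m.testBit i = true := (testBit_ones c i).2 hi
    have hL : ∀ p, has X p i ↔ p ∈ insert 0 (insert t C) := by
      intro p
      rw [hX, has_zor, has_app_zeros, Finset.mem_insert, Finset.mem_insert]
      have e1 : (t ≤ p ∧ has (cons m nil) (p - t) i) ↔ p = t := by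
        constructor
        · rintro ⟨h2, h3⟩
          rcases h4 : p - t with _ | d
          · omega
          · rw [h4] at h3
            exact h3.elim
        · rintro rfl
          exact ⟨le_rfl, by simpa using hmi⟩
      rw [e1]
      rcases p with _ | p
      · simp [hmi]
      · rw [has_cons_succ, has_app_zeros]
        have e2 : (Nat.pred v0 ≤ p ∧ has x (p - Nat.pred v0) i) ↔ p + 1 ∈ C := by
          rw [hiC]
          constructor
          · rintro ⟨h2, h3⟩
            rw [Nat.pred_eq_sub_one] at h2 h3
            rwa [show v0 + (p - (v0 - 1)) = p + 1 by omega] at h3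
          · intro h2
            have := (hC.2.1 _ h2).1
            rw [Nat.pred_eq_sub_one]
            refine ⟨by omega, ?_⟩
            rwa [show v0 + (p - (v0 - 1)) = p + 1 by omega]
        rw [e2]
        simp only [Nat.add_eq_zero_iff, one_ne_zero, and_false, false_or]
        exact or_comm
    obtain ⟨i', hi'⟩ := hlane i (by
      rw [testBit_xor]
      intro hb
      obtain ⟨d, p, q, hpq, h2, h3, h4, h5⟩ := testBit_bad (hb.1 hmi)
      rw [has_tl, hL] at h3 h5
      rw [hL] at h2 h4
      rcases hsid p h2 _ h5 q h4 _ h3 (by omega) with h6 | h6 <;> omega)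
    exact ⟨i', Finset.mem_insert_self _ _, fun p => (hi' p).1.trans (hL p)⟩

theorem exists_of_spread {X : NL} {k : NL → Bool} {n z : ℕ} {acc : NL}
    (h : spread X k n acc (zeros z) = true) :
    ∃ acc', k acc' = true ∧ (∀ i B, Lane acc i B → ∃ j, Lane acc' j B) ∧
      ∀ i S u, Lane X i S → u < n →
        ∃ j, Lane acc' j (insert 0 (S.image fun s => s + (z + u + 1))) := by
  induction n generalizing z acc with
  | zero => exact ⟨acc, h, fun i B hB => ⟨i, hB⟩, fun _ _ _ _ hu => absurd hu (by omega)⟩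
  | succ n ih =>
    change cat acc (cons (hd X) (app (zeros z) X))
      (fun acc => spread X k n acc (zeros (z + 1))) = true at h
    obtain ⟨acc₁, h1, hacc, hnew⟩ := exists_of_cat h
    obtain ⟨acc₂, h2, hacc₂, hrest⟩ := ih h1
    refine ⟨acc₂, h2, fun i B hB => hacc₂ i B (hacc i B hB), fun i S u hS hu => ?_⟩
    rcases u with _ | u
    · obtain ⟨j, hj⟩ := hnew i (insert 0 (S.image fun s => s + (z + 0 + 1)))
        ⟨Finset.mem_insert_self _ _, fun p => by
          rcases p with _ | p
          · simp [testBit_hd, hS.2, hS.1]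
          · rw [has_cons_succ, has_app_zeros, hS.2, Finset.mem_insert, Finset.mem_image]
            constructor
            · rintro ⟨h3, h4⟩
              exact Or.inr ⟨_, h4, by omega⟩
            · rintro (h3 | ⟨s, h3, h4⟩)
              · omega
              · obtain rfl : p = s + z := by omega
                exact ⟨by omega, by rwa [Nat.add_sub_cancel]⟩⟩
      exact hacc₂ j _ hj
    · have := hrest i S u hS (by omega)
      rwa [show z + 1 + u + 1 = z + (u + 1) + 1 by omega] at this

theorem Lane.revN {X : NL} {i t : ℕ} {Z : Finset ℕ} (h : Lane X i Z) (ht : t ∈ Z)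
    (hZ : ∀ z ∈ Z, z ≤ t) : Lane (revN (Nat.succ t) X nil) i (Z.image fun z => t - z) := by
  refine ⟨Finset.mem_image.2 ⟨t, ht, by omega⟩, fun p => ?_⟩
  rw [has_revN, h.2, Finset.mem_image]
  constructor
  · rintro (⟨h1, h2⟩ | ⟨_, h2⟩)
    · exact ⟨_, h2, by omega⟩
    · exact h2.elim
  · rintro ⟨z, h1, rfl⟩
    have := hZ z h1
    exact Or.inl ⟨by omega, by rwa [show Nat.succ t - 1 - (t - z) = z by omega]⟩

theorem minLen_eq (t : ℕ) : minLen t = max 97 (2 * t + 1) := by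
  have : minLen t = if Nat.ble 97 (2 * t + 1) = true then 2 * t + 1 else 97 := boolRec ..
  rw [this]
  split_ifs with h <;> rw [Nat.ble_eq] at h <;> omega

/-- Specifications as a list of type `SL`. -/
def toSL (l : List (ℕ × ℕ × ℕ)) : SL :=
  List.rec SL.nil (fun s _ ih => SL.cons s.1 s.2.1 s.2.2 ih) l

theorem exists_of_gather {K : ℕ} {k : NL → Bool} {l : List (ℕ × ℕ × ℕ)} {acc : NL}
    (hl : ∀ s ∈ l, 1 ≤ s.2.1 ∧ s.2.1 ≤ s.2.2 ∧ s.2.2 ≤ s.1)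
    (h : gather K k (toSL l) acc = true) :
    ∃ acc', k acc' = true ∧ (∀ i B, Lane acc i B → ∃ j, Lane acc' j B) ∧
      ∀ t v0 v1, (t, v0, v1) ∈ l → 109 ≤ K + t ∧
        ∀ C, Fam v1 t v0 5 C → Sid (insert 0 (insert t C)) → ∀ L, minLen t ≤ L → L ≤ 110 →
          ∃ j, Lane acc' j (insert 0 ((insert 0 (insert t C)).image fun z => L - z)) := by
  induction l generalizing acc with
  | nil => exact ⟨acc, h, fun i B hB => ⟨i, hB⟩, fun _ _ _ h => by simp at h⟩
  | cons s l ih =>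
    obtain ⟨t, v0, v1⟩ := s
    change (Bool.rec false (tabl t v0 v1 (fun X => spread (revN (Nat.succ t) X nil)
      (gather K k (toSL l)) (Nat.sub 111 (minLen t)) acc
      (zeros (Nat.pred (Nat.sub (minLen t) t))))) (Nat.ble 109 (Nat.add K t)) : Bool) = true at h
    rw [boolRec] at h
    split_ifs at h with h1
    rw [Nat.ble_eq] at h1
    obtain ⟨h2, h3, h4⟩ := hl _ List.mem_cons_self
    obtain ⟨X, hX, hlane⟩ := exists_of_tabl h h2 h3 h4
    obtain ⟨acc₁, h5, hacc₁, hnew⟩ := exists_of_spread hX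
    obtain ⟨acc₂, h6, hacc₂, hrest⟩ := ih (fun s hs => hl s (List.mem_cons_of_mem _ hs)) h5
    refine ⟨acc₂, h6, fun i B hB => ?_, fun t' v0' v1' hmem => ?_⟩
    · obtain ⟨j, hj⟩ := hacc₁ i B hB
      exact hacc₂ j B hj
    · rcases List.mem_cons.1 hmem with e | hmem
      · simp only [Prod.mk.injEq] at e
        obtain ⟨rfl, rfl, rfl⟩ := e
        refine ⟨h1, fun C hC hsid L hL1 hL2 => ?_⟩
        obtain ⟨i, hi⟩ := hlane C hC hsid
        have hle : ∀ z ∈ insert 0 (insert t' C), z ≤ t' := by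
          intro z hz
          rcases Finset.mem_insert.1 hz with rfl | hz
          · omega
          · rcases Finset.mem_insert.1 hz with rfl | hz
            · exact le_rfl
            · exact (hC.2.1 z hz).2.le
        have ht : t' < minLen t' := by
          rw [minLen_eq]
          omega
        obtain ⟨j, hj⟩ := hnew i _ (L - minLen t')
          (hi.revN (Finset.mem_insert_of_mem (Finset.mem_insert_self _ _)) hle)
          (show L - minLen t' < 111 - minLen t' by omega)
        obtain ⟨j', hj'⟩ := hacc₂ j _ hj
        refine ⟨j', ?_⟩
        convert hj' using 2
        rw [Finset.image_image]
        refine Finset.image_congr fun z hz => ?_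
        have := hle z hz
        change L - z = t' - z + (minLen t' - t' - 1 + (L - minLen t') + 1)
        omega
      · exact hrest t' v0' v1' hmem

/-- A Sidon set with seven smallest elements `0`, `C`, `t` and five more elements, given by `D`,
is described by the codes, up to reflection. -/
theorem exists_of_block {codes : NL} {K : ℕ} {l : List (ℕ × ℕ × ℕ)}
    (hl : ∀ s ∈ l, 1 ≤ s.2.1 ∧ s.2.1 ≤ s.2.2 ∧ s.2.2 ≤ s.1)
    (h : block codes K (toSL l) = true) {t v0 v1 L : ℕ} (ht : (t, v0, v1) ∈ l)
    {C D : Finset ℕ} (hC : Fam v1 t v0 5 C) (hL1 : 97 ≤ L) (hL2 : L ≤ 110) (htL : 2 * t < L)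
    (hD : D.card = 5) (hDL : ∀ d ∈ D, t < d ∧ d < L)
    (hsid : Sid (insert 0 (insert t (insert L (C ∪ D))))) :
    ∃ q, codes.Mem q ∧
      ∀ z ∈ insert 0 (insert t (insert L (C ∪ D))), q.testBit (L - z) = true := by
  obtain ⟨M, h1, -, h2⟩ := exists_of_gather hl h
  obtain ⟨hK, h3⟩ := h2 t v0 v1 ht
  set Z := insert 0 (insert t (insert L (C ∪ D))) with hZ
  set E := insert 0 (insert t C) with hE
  have hEle : ∀ z ∈ E, z ≤ t := by
    intro z hz
    rw [hE, Finset.mem_insert, Finset.mem_insert] at hz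
    rcases hz with rfl | rfl | hz
    · omega
    · exact le_rfl
    · exact (hC.2.1 z hz).2.le
  have hZmem : ∀ z, z ∈ Z ↔ z ∈ E ∨ z = L ∨ z ∈ D := by
    intro z
    simp only [hZ, hE, Finset.mem_insert, Finset.mem_union]
    tauto
  have hZle : ∀ z ∈ Z, z ≤ L := by
    intro z hz
    rcases (hZmem z).1 hz with hz | rfl | hz
    · have := hEle z hz
      omega
    · exact le_rfl
    · exact (hDL z hz).2.le
  have hEsid : Sid E := by
    have hEZ : ∀ z ∈ E, z ∈ Z := fun z hz => (hZmem z).2 (Or.inl hz)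
    exact fun a ha b hb c hc d hd => hsid a (hEZ a ha) b (hEZ b hb) c (hEZ c hc) d (hEZ d hd)
  obtain ⟨j, hj⟩ := h3 C hC hEsid L (by rw [minLen_eq]; omega) hL2
  set B := insert 0 (E.image fun z => L - z) with hB
  have hBmem : ∀ b ∈ B, b = 0 ∨ ∃ z ∈ E, b = L - z := by
    intro b hb
    rw [hB, Finset.mem_insert, Finset.mem_image] at hb
    rcases hb with hb | ⟨z, hz, rfl⟩
    · exact Or.inl hb
    · exact Or.inr ⟨z, hz, rfl⟩
  have hcmem : ∀ c ∈ D.image fun z => L - z, ∃ d ∈ D, c = L - d := by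
    intro c hc
    obtain ⟨d, hd, rfl⟩ := Finset.mem_image.1 hc
    exact ⟨d, hd, rfl⟩
  have hBC : ∀ b, b ∈ B ∪ D.image (fun z => L - z) ↔ ∃ z ∈ Z, b = L - z := by
    intro b
    rw [Finset.mem_union]
    constructor
    · rintro (hb | hb)
      · rcases hBmem b hb with rfl | ⟨z, hz, rfl⟩
        · exact ⟨L, (hZmem L).2 (Or.inr (Or.inl rfl)), by omega⟩
        · exact ⟨z, (hZmem z).2 (Or.inl hz), rfl⟩
      · obtain ⟨z, hz, rfl⟩ := hcmem b hb
        exact ⟨z, (hZmem z).2 (Or.inr (Or.inr hz)), rfl⟩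
    · rintro ⟨z, hz, rfl⟩
      rcases (hZmem z).1 hz with hz | rfl | hz
      · exact Or.inl (Finset.mem_insert_of_mem (Finset.mem_image_of_mem _ hz))
      · exact Or.inl (by rw [Nat.sub_self]; exact Finset.mem_insert_self _ _)
      · exact Or.inr (Finset.mem_image_of_mem _ hz)
  obtain ⟨q, hq, hqB⟩ := exists_of_run le_rfl h1 hj (C := D.image fun z => L - z)
    (by
      rw [Finset.card_image_of_injOn, hD]
      intro a ha b hb e
      have h4 := hDL a ha
      have h5 := hDL b hb
      simp only at e
      omega)
    (by
      intro c hc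
      obtain ⟨d, hd, rfl⟩ := hcmem c hc
      have := hDL d hd
      omega)
    (by
      intro c hc hcB
      obtain ⟨d, hd, rfl⟩ := hcmem c hc
      have h4 := hDL d hd
      rcases hBmem _ hcB with h5 | ⟨z, hz, h5⟩
      · omega
      · have := hEle z hz
        omega)
    (by
      intro c hc
      obtain ⟨d, hd, rfl⟩ := hcmem c hc
      have h4 := hDL d hd
      have : B.filter (· ≤ L - d) = {0} := by
        ext b
        rw [Finset.mem_filter, Finset.mem_singleton]
        constructor
        · rintro ⟨hb, hbd⟩
          rcases hBmem b hb with rfl | ⟨z, hz, rfl⟩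
          · rfl
          · have := hEle z hz
            omega
        · rintro rfl
          exact ⟨Finset.mem_insert_self _ _, Nat.zero_le _⟩
      rw [cnt, this, Finset.card_singleton])
    (by
      intro a ha b hb c hc d hd e
      rw [hBC] at ha hb hc hd
      obtain ⟨a, ha, rfl⟩ := ha
      obtain ⟨b, hb, rfl⟩ := hb
      obtain ⟨c, hc, rfl⟩ := hc
      obtain ⟨d, hd, rfl⟩ := hd
      have ha' := hZle a ha
      have hb' := hZle b hb
      have hc' := hZle c hc
      have hd' := hZle d hd
      rcases hsid a ha b hb c hc d hd (by omega) with rfl | rfl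
      · exact Or.inl rfl
      · exact Or.inr rfl)
  exact ⟨q, hq, fun z hz => hqB _ ((hBC _).2 ⟨z, hz, rfl⟩)⟩

/-! ### The computation -/

/-- The Sidon sets with 13 elements and length between 97 and 110, up to reflection. -/
def codeList : List ℕ :=
  [82081034021604892195585852964901,
    974189491129992227595779053717665,
    892435935790173306786209524123713,
    812722491222446220015576159881281,
    2109370753824814465447521658605585,
    1967433345824382269491277224477705,
    1461620949198261289173229825949745]

/-- The Sidon sets with 13 elements in `[1, 111]`. -/
def masks : List ℕ :=
  [164162068043209784391171705929802,
    207894703274331938950379565482754,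
    328324136086419568782343411859604,
    415789406548663877900759130965508,
    656648272172839137564686823719208,
    831578813097327755801518261931016,
    1313296544345678275129373647438416,
    1663157626194655511603036523862032,
    2626593088691356550258747294876832,
    3326315252389311023206073047724064,
    1948378982259984455191558107435330,
    1349414066360949413608432366258182,
    3896757964519968910383116214870660,
    2698828132721898827216864732516364,
    1784871871580346613572419048247426,
    1319030063637623938072444978462746,
    3569743743160693227144838096494852,
    2638060127275247876144889956925492,
    1625444982444892440031152319762562,
    1318992925578111724279870940783626,
    3250889964889784880062304639525124,
    2637985851156223448559741881567252,
    4218741507649628930895043317211170,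
    2759051512288308607487072880558102,
    3934866691648764538982554448955410,
    2923202941781961317094565729075334,
    2923241898396522578346459651899490,
    2839542315614351688730911791253522]

/-- A list as an element of `NL`. -/
def toNL (l : List ℕ) : NL := List.rec NL.nil (fun x _ ih => NL.cons x ih) l

def codes : NL := toNL codeList

/-- Batches `(K, l)` for the search: for each `(t, v₀, v₁)` in `l` the starting sets have smallest
positive element in `[v₀, v₁)` and largest element `t`, and the other elements are in `[1, K]`. -/
def plan : List (ℕ × List (ℕ × ℕ × ℕ)) :=
  [(103, [
      (6, 1, 2), (7, 1, 3), (8, 1, 4), (9, 1, 5), (10, 1, 6), (11, 1, 7), (12, 1, 8), (13, 1, 9),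
      (14, 1, 10), (15, 1, 11), (16, 1, 12), (17, 1, 13), (18, 1, 14), (19, 1, 15), (20, 1, 16),
      (21, 1, 17), (22, 1, 18), (23, 1, 19), (24, 1, 20)]),
    (84, [
      (25, 1, 21), (26, 1, 22), (27, 1, 23), (28, 1, 24), (29, 1, 25), (30, 1, 26), (31, 1, 27),
      (32, 1, 28), (33, 1, 29), (34, 1, 30), (35, 1, 31), (36, 1, 32)]),
    (72, [
      (37, 1, 33), (38, 1, 34)]),
    (70, [
      (39, 1, 35)]),
    (69, [
      (40, 1, 36)]),
    (68, [
      (41, 1, 14)]),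
    (68, [
      (41, 14, 37)]),
    (67, [
      (42, 1, 10)]),
    (67, [
      (42, 10, 38)]),
    (66, [
      (43, 1, 6)]),
    (66, [
      (43, 6, 39)]),
    (65, [
      (44, 1, 5)]),
    (65, [
      (44, 5, 40)]),
    (64, [
      (45, 1, 4)]),
    (64, [
      (45, 4, 9)]),
    (64, [
      (45, 9, 41)]),
    (63, [
      (46, 1, 3)]),
    (63, [
      (46, 3, 6)]),
    (63, [
      (46, 6, 13)]),
    (63, [
      (46, 13, 42)]),
    (62, [
      (47, 1, 3)]),
    (62, [
      (47, 3, 5)]),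
    (62, [
      (47, 5, 8)]),
    (62, [
      (47, 8, 15)]),
    (62, [
      (47, 15, 43), (48, 1, 2)]),
    (61, [
      (48, 2, 4)]),
    (61, [
      (48, 4, 6)]),
    (61, [
      (48, 6, 9)]),
    (61, [
      (48, 9, 16)]),
    (61, [
      (48, 16, 44), (49, 1, 2)]),
    (60, [
      (49, 2, 3)]),
    (60, [
      (49, 3, 5)]),
    (60, [
      (49, 5, 7)]),
    (60, [
      (49, 7, 11)]),
    (60, [
      (49, 11, 25)]),
    (60, [
      (49, 25, 45), (50, 1, 2)]),
    (59, [
      (50, 2, 4)]),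
    (59, [
      (50, 4, 6)]),
    (59, [
      (50, 6, 10)]),
    (59, [
      (50, 10, 21)]),
    (59, [
      (50, 21, 46), (51, 1, 2)]),
    (58, [
      (51, 2, 4)]),
    (58, [
      (51, 4, 6)]),
    (58, [
      (51, 6, 9)]),
    (58, [
      (51, 9, 15)]),
    (58, [
      (51, 15, 47)]),
    (57, [
      (52, 1, 3)]),
    (57, [
      (52, 3, 6)]),
    (57, [
      (52, 6, 11)]),
    (57, [
      (52, 11, 48)]),
    (56, [
      (53, 1, 4)]),
    (56, [
      (53, 4, 8)]),
    (56, [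
      (53, 8, 17)]),
    (56, [
      (53, 17, 49)]),
    (55, [
      (54, 1, 7)]),
    (55, [
      (54, 7, 50)])]

set_option maxHeartbeats 0 in
theorem block_plan : ∀ b ∈ plan, block codes b.1 (toSL b.2) = true := by
  simp only [plan, List.forall_mem_cons, List.not_mem_nil, false_imp_iff, implies_true, and_true]
  and_intros <;> decide +kernel

theorem plan_valid : ∀ b ∈ plan, ∀ s ∈ b.2, 1 ≤ s.2.1 ∧ s.2.1 ≤ s.2.2 ∧ s.2.2 ≤ s.1 := by
  decide +kernel

set_option synthInstance.maxSize 2000 in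
theorem plan_covers : ∀ t < 55, ∀ v < t - 4, 1 ≤ v →
    ∃ b ∈ plan, ∃ s ∈ b.2, s.1 = t ∧ s.2.1 ≤ v ∧ v < s.2.2 := by
  decide +kernel

theorem card_codeList :
    ∀ q ∈ codeList, ((Finset.range 111).filter fun p => q.testBit p = true).card = 13 := by
  decide +kernel

set_option synthInstance.maxSize 2000 in
theorem masks_complete : ∀ q ∈ codeList, ∀ L < 111, q.testBit L = true →
    (∀ p < 111, q.testBit p = true → p ≤ L) → ∀ m < 112, 1 ≤ m → m + L ≤ 111 →
      (∃ w ∈ masks, ∀ p < 111, q.testBit p = true → w.testBit (m + p) = true) ∧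
        ∃ w ∈ masks, ∀ p < 111, q.testBit p = true → w.testBit (m + (L - p)) = true := by
  decide +kernel

theorem card_masks :
    ∀ w ∈ masks, ((Finset.range 112).filter fun p => w.testBit p = true).card = 13 := by
  decide +kernel

theorem masks_meet : ∀ w₁ ∈ masks, ∀ w₂ ∈ masks, ∀ w₃ ∈ masks,
    w₁ &&& w₂ ≠ 0 ∨ w₁ &&& w₃ ≠ 0 ∨ w₂ &&& w₃ ≠ 0 := by
  decide +kernel

theorem masks_lt : ∀ w ∈ masks, w < 2 ^ 112 := by
  decide +kernel

theorem NL.mem_toNL {q : ℕ} {l : List ℕ} (h : (toNL l).Mem q) : q ∈ l := by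
  induction l with
  | nil => exact h.elim
  | cons x l ih =>
    rcases h with h | h
    · exact List.mem_cons.2 (Or.inl h)
    · exact List.mem_cons_of_mem _ (ih h)

/-! ### Sidon sets with 13 elements -/

/-- Sum of the differences of order at most three. -/
theorem length_of_strictMono {x : ℕ → ℕ} (hx : ∀ i j, i < j → j < 13 → x i < x j)
    (hsid : ∀ i < 13, ∀ j < 13, ∀ k < 13, ∀ l < 13,
      x i + x j = x k + x l → x i = x k ∨ x i = x l) : x 0 + 97 ≤ x 12 := by
  have hinj : ∀ i < 13, ∀ j < 13, x i = x j → i = j := by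
    intro i hi j hj e
    rcases lt_trichotomy i j with h | h | h
    · have := hx i j h hj
      omega
    · exact h
    · have := hx j i h hi
      omega
  have hdiff : ∀ i j k l, i < j → j < 13 → k < l → l < 13 →
      x j + x k = x l + x i → i = k ∧ j = l := by
    intro i j k l hij hj hkl hl e
    have h1 := hx i j hij hj
    rcases hsid j hj k (by omega) l hl i (by omega) e with h | h
    · exact ⟨hinj i (by omega) k (by omega) (by omega), hinj j hj l hl h⟩
    · omega
  set P : Finset (Σ _ : ℕ, ℕ) := (Finset.range 3).sigma fun k => Finset.range (12 - k) with hP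
  set f : (Σ _ : ℕ, ℕ) → ℤ := fun p => (x (p.2 + p.1 + 1) : ℤ) - x p.2 with hf
  have hPmem : ∀ p ∈ P, p.1 < 3 ∧ p.2 + p.1 + 1 < 13 := by
    intro p hp
    simp only [hP, Finset.mem_sigma, Finset.mem_range] at hp
    omega
  have hfinj : Set.InjOn f P := by
    rintro ⟨k, i⟩ hp ⟨l, j⟩ hq e
    have h1 := hPmem _ hp
    have h2 := hPmem _ hq
    simp only at h1 h2
    simp only [hf] at e
    obtain ⟨h3, h4⟩ := hdiff i (i + k + 1) j (j + l + 1) (by omega) (by omega) (by omega)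
      (by omega) (by omega)
    subst h3
    obtain rfl : k = l := by omega
    rfl
  have hpos : ∀ d ∈ P.image f, (1 : ℤ) ≤ d := by
    intro d hd
    obtain ⟨⟨k, i⟩, hp, rfl⟩ := Finset.mem_image.1 hd
    have h1 := hPmem _ hp
    have := hx i (i + k + 1) (by omega) (by simpa using h1.2)
    simp only [hf]
    omega
  have hsum := Finset.sum_range_le_sum hpos
  rw [Finset.card_image_of_injOn hfinj, Finset.sum_image hfinj,
    show P.card = 33 by rw [hP]; rfl, hP, Finset.sum_sigma] at hsum
  simp only [hf, Finset.sum_range_succ, Finset.sum_range_zero] at hsum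
  have h01 := hx 0 1 (by omega) (by omega)
  have h12 := hx 1 2 (by omega) (by omega)
  have hab := hx 10 11 (by omega) (by omega)
  have hbc := hx 11 12 (by omega) (by omega)
  have d1 := fun e => hdiff 0 1 1 2 (by omega) (by omega) (by omega) (by omega) e
  have d2 := fun e => hdiff 0 1 10 11 (by omega) (by omega) (by omega) (by omega) e
  have d3 := fun e => hdiff 0 1 11 12 (by omega) (by omega) (by omega) (by omega) e
  have d4 := fun e => hdiff 1 2 10 11 (by omega) (by omega) (by omega) (by omega) e
  have d5 := fun e => hdiff 1 2 11 12 (by omega) (by omega) (by omega) (by omega) e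
  have d6 := fun e => hdiff 10 11 11 12 (by omega) (by omega) (by omega) (by omega) e
  norm_num at hsum d1 d2 d3 d4 d5 d6
  omega

theorem exists_code_of_half {t L : ℕ} {C D : Finset ℕ} (hC : C.card = 5) (hD : D.card = 5)
    (hCt : ∀ c ∈ C, 0 < c ∧ c < t) (hDL : ∀ d ∈ D, t < d ∧ d < L) (hL1 : 97 ≤ L) (hL2 : L ≤ 110)
    (htL : 2 * t < L) (hsid : Sid (insert 0 (insert t (insert L (C ∪ D))))) :
    ∃ q ∈ codeList, ∀ z ∈ insert 0 (insert t (insert L (C ∪ D))), q.testBit (L - z) = true := by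
  have hne : C.Nonempty := by
    rw [← Finset.card_pos]
    omega
  have hv := C.min'_mem hne
  set v := C.min' hne with hvdef
  have hvle : ∀ c ∈ C, v ≤ c := fun c hc => C.min'_le c hc
  have hvt : v < t - 4 := by
    have : C ⊆ Finset.Ico v t := fun c hc => Finset.mem_Ico.2 ⟨hvle c hc, (hCt c hc).2⟩
    have := Finset.card_le_card this
    rw [Nat.card_Ico] at this
    omega
  obtain ⟨⟨K, l⟩, hb, ⟨t', v0, v1⟩, hs, h1, h2, h3⟩ :=
    plan_covers t (by omega) v hvt (hCt v hv).1
  simp only at h1 h2 h3 hs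
  subst h1
  obtain ⟨q, hq, hqZ⟩ := exists_of_block (plan_valid _ hb) (block_plan _ hb) hs (C := C) (D := D)
    ⟨hC, fun c hc => ⟨h2.trans (hvle c hc), (hCt c hc).2⟩, fun _ => ⟨v, hv, h3⟩⟩
    hL1 hL2 htL hD hDL hsid
  exact ⟨q, NL.mem_toNL hq, hqZ⟩

theorem Sid.reflect {Z : Finset ℕ} (h : Sid Z) {L : ℕ} (hZ : ∀ z ∈ Z, z ≤ L) :
    Sid (Z.image fun z => L - z) := by
  intro a ha b hb c hc d hd e
  obtain ⟨a, ha₁, rfl⟩ := Finset.mem_image.1 ha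
  obtain ⟨b, hb₁, rfl⟩ := Finset.mem_image.1 hb
  obtain ⟨c, hc₁, rfl⟩ := Finset.mem_image.1 hc
  obtain ⟨d, hd₁, rfl⟩ := Finset.mem_image.1 hd
  have ha' := hZ a ha₁
  have hb' := hZ b hb₁
  have hc' := hZ c hc₁
  have hd' := hZ d hd₁
  rcases h a ha₁ b hb₁ c hc₁ d hd₁ (by omega) with h1 | h1
  · exact Or.inl (by rw [h1])
  · exact Or.inr (by rw [h1])

theorem exists_code {Z : Finset ℕ} {L : ℕ} (hcard : Z.card = 13) (hsid : Sid Z) (h0 : 0 ∈ Z)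
    (hL : L ∈ Z) (hZ : ∀ z ∈ Z, z ≤ L) (hL2 : L ≤ 110) :
    ∃ q ∈ codeList, (∀ z ∈ Z, q.testBit (L - z) = true) ∨ ∀ z ∈ Z, q.testBit z = true := by
  set e := Z.orderEmbOfFin hcard with he
  set x : ℕ → ℕ := fun n => e (Fin.ofNat 13 n) with hxdef
  have hx : ∀ i j, i < j → j < 13 → x i < x j := by
    intro i j hij hj
    refine e.strictMono ?_
    rw [Fin.lt_def]
    simp only [Fin.ofNat]
    rwa [Nat.mod_eq_of_lt hj, Nat.mod_eq_of_lt (hij.trans hj)]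
  have hmem : ∀ n, x n ∈ Z := fun n => Z.orderEmbOfFin_mem hcard _
  have hsurj : ∀ z ∈ Z, ∃ n < 13, x n = z := by
    intro z hz
    have : z ∈ Set.range (Z.orderEmbOfFin hcard) := by
      rw [Finset.range_orderEmbOfFin]
      exact hz
    obtain ⟨⟨n, hn⟩, rfl⟩ := this
    refine ⟨n, hn, ?_⟩
    simp only [hxdef, he]
    congr 1
    ext
    exact Nat.mod_eq_of_lt hn
  have hle : ∀ i j, i ≤ j → j < 13 → x i ≤ x j := by
    intro i j hij hj
    rcases hij.eq_or_lt with rfl | h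
    · exact le_rfl
    · exact (hx i j h hj).le
  have hx0 : x 0 = 0 := by
    obtain ⟨n, hn, h⟩ := hsurj 0 h0
    have := hle 0 n (Nat.zero_le n) hn
    omega
  have hx12 : x 12 = L := by
    obtain ⟨n, hn, h⟩ := hsurj L hL
    have h1 := hle n 12 (by omega) (by omega)
    have h2 := hZ _ (hmem 12)
    omega
  have hL1 : 97 ≤ L := by
    have := length_of_strictMono hx fun i _ j _ k _ l _ h =>
      hsid _ (hmem i) _ (hmem j) _ (hmem k) _ (hmem l) h
    omega
  clear hxdef
  clear_value x
  obtain ⟨t, ht⟩ : ∃ t, x 6 = t := ⟨_, rfl⟩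
  have htZ : t ∈ Z := ht ▸ hmem 6
  have hinj : ∀ a b, b ≤ 13 → Set.InjOn x (Finset.Ico a b) := by
    intro a b hb i hi j hj h
    have hi' := Finset.mem_Ico.1 hi
    have hj' := Finset.mem_Ico.1 hj
    rcases lt_trichotomy i j with h1 | h1 | h1
    · have := hx i j h1 (by omega)
      omega
    · exact h1
    · have := hx j i h1 (by omega)
      omega
  set C := (Finset.Ico 1 6).image x with hCdef
  set D := (Finset.Ico 7 12).image x with hDdef
  have hC : C.card = 5 := by
    rw [hCdef, Finset.card_image_of_injOn (hinj 1 6 (by omega)), Nat.card_Ico]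
  have hD : D.card = 5 := by
    rw [hDdef, Finset.card_image_of_injOn (hinj 7 12 (by omega)), Nat.card_Ico]
  have hCt : ∀ c ∈ C, 0 < c ∧ c < t := by
    intro c hc
    obtain ⟨i, hi, rfl⟩ := Finset.mem_image.1 hc
    rw [Finset.mem_Ico] at hi
    have h1 := hx 0 i (by omega) (by omega)
    have h2 := hx i 6 (by omega) (by omega)
    omega
  have hDL : ∀ d ∈ D, t < d ∧ d < L := by
    intro d hd
    obtain ⟨i, hi, rfl⟩ := Finset.mem_image.1 hd
    rw [Finset.mem_Ico] at hi
    have h1 := hx 6 i (by omega) (by omega)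
    have h2 := hx i 12 (by omega) (by omega)
    omega
  have hZeq : Z = insert 0 (insert t (insert L (C ∪ D))) := by
    ext z
    simp only [Finset.mem_insert, Finset.mem_union]
    constructor
    · intro hz
      obtain ⟨n, hn, rfl⟩ := hsurj z hz
      rcases lt_trichotomy n 6 with h | rfl | h
      · rcases n.eq_zero_or_pos with rfl | h'
        · exact Or.inl hx0
        · exact Or.inr (Or.inr (Or.inr (Or.inl (Finset.mem_image_of_mem _
            (Finset.mem_Ico.2 ⟨h', h⟩)))))
      · exact Or.inr (Or.inl ht)
      · rcases (show n ≤ 12 by omega).eq_or_lt with rfl | h'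
        · exact Or.inr (Or.inr (Or.inl hx12))
        · exact Or.inr (Or.inr (Or.inr (Or.inr (Finset.mem_image_of_mem _
            (Finset.mem_Ico.2 ⟨h, h'⟩)))))
    · rintro (h | h | h | hz | hz)
      · exact h ▸ h0
      · exact h ▸ htZ
      · exact h ▸ hL
      · obtain ⟨i, -, rfl⟩ := Finset.mem_image.1 hz
        exact hmem i
      · obtain ⟨i, -, rfl⟩ := Finset.mem_image.1 hz
        exact hmem i
  have htL : 2 * t ≠ L := by
    intro h
    have h1 := hx 0 6 (by omega) (by omega)
    rcases hsid 0 h0 L hL t htZ t htZ (by omega) with h2 | h2 <;> omega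
  rcases lt_or_gt_of_ne htL with h | h
  · rw [hZeq] at hsid
    obtain ⟨q, hq, hqZ⟩ := exists_code_of_half hC hD hCt hDL hL1 hL2 h hsid
    refine ⟨q, hq, Or.inl fun z hz => hqZ z ?_⟩
    rwa [hZeq] at hz
  · have htle := hZ t htZ
    have himg : insert 0 (insert (L - t) (insert L
        (D.image (fun z => L - z) ∪ C.image fun z => L - z))) = Z.image fun z => L - z := by
      conv_rhs => rw [hZeq]
      simp only [Finset.image_insert, Finset.image_union, Nat.sub_zero, Nat.sub_self]
      rw [Finset.union_comm, Finset.insert_comm L (L - t), Finset.insert_comm L 0,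
        Finset.insert_comm (L - t) 0]
    have hrefl := hsid.reflect hZ
    rw [← himg] at hrefl
    obtain ⟨q, hq, hqZ⟩ := exists_code_of_half
      (by
        rw [Finset.card_image_of_injOn, hD]
        intro a ha b hb e
        have h1 := hDL a ha
        have h2 := hDL b hb
        simp only at e
        omega)
      (by
        rw [Finset.card_image_of_injOn, hC]
        intro a ha b hb e
        have h1 := hCt a ha
        have h2 := hCt b hb
        simp only at e
        omega)
      (by
        intro c hc
        obtain ⟨d, hd, rfl⟩ := Finset.mem_image.1 hc
        have := hDL d hd
        omega)
      (by
        intro c hc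
        obtain ⟨d, hd, rfl⟩ := Finset.mem_image.1 hc
        have := hCt d hd
        omega)
      hL1 hL2 (by omega) hrefl
    refine ⟨q, hq, Or.inr fun z hz => ?_⟩
    have := hqZ (L - z) (by
      rw [himg]
      exact Finset.mem_image_of_mem _ hz)
    have h1 := hZ z hz
    rwa [show L - (L - z) = z by omega] at this

/-- A set of 13 elements contained in the set with code `q` is equal to it. -/
theorem mem_of_testBit {q n : ℕ} {Z : Finset ℕ}
    (hq : ((Finset.range n).filter fun p => q.testBit p = true).card = 13) (hZ : Z.card = 13)
    (h : ∀ z ∈ Z, z < n ∧ q.testBit z = true) {p : ℕ} (hp : p < n) (hpq : q.testBit p = true) :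
    p ∈ Z := by
  have hsub : Z ⊆ (Finset.range n).filter fun p => q.testBit p = true := by
    intro z hz
    rw [Finset.mem_filter, Finset.mem_range]
    exact h z hz
  rw [Finset.eq_of_subset_of_card_le hsub (by omega), Finset.mem_filter, Finset.mem_range]
  exact ⟨hp, hpq⟩

theorem exists_mask {S : Finset ℕ} (hcard : S.card = 13) (hsid : Sid S)
    (hS : ∀ s ∈ S, 1 ≤ s ∧ s ≤ 111) : ∃ w ∈ masks, ∀ p, w.testBit p = true → p ∈ S := by
  have hne : S.Nonempty := by
    rw [← Finset.card_pos]
    omega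
  set m := S.min' hne with hm
  set M := S.max' hne with hM
  have hmS : m ∈ S := S.min'_mem hne
  have hMS : M ∈ S := S.max'_mem hne
  have hmle : ∀ s ∈ S, m ≤ s := fun s hs => S.min'_le s hs
  have hleM : ∀ s ∈ S, s ≤ M := fun s hs => S.le_max' s hs
  have h1 := hS m hmS
  have h2 := hS M hMS
  have h3 := hmle M hMS
  set Z := S.image fun s => s - m with hZdef
  have hZmem : ∀ z ∈ Z, ∃ s ∈ S, z = s - m := by
    intro z hz
    obtain ⟨s, hs, rfl⟩ := Finset.mem_image.1 hz
    exact ⟨s, hs, rfl⟩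
  have hSZ : ∀ s ∈ S, s - m ∈ Z := fun s hs => Finset.mem_image_of_mem _ hs
  have hZcard : Z.card = 13 := by
    rw [hZdef, Finset.card_image_of_injOn, hcard]
    intro a ha b hb e
    have ha' := hmle a ha
    have hb' := hmle b hb
    simp only at e
    omega
  have hZsid : Sid Z := by
    intro a ha b hb c hc d hd e
    obtain ⟨a, ha₁, rfl⟩ := hZmem a ha
    obtain ⟨b, hb₁, rfl⟩ := hZmem b hb
    obtain ⟨c, hc₁, rfl⟩ := hZmem c hc
    obtain ⟨d, hd₁, rfl⟩ := hZmem d hd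
    have ha' := hmle a ha₁
    have hb' := hmle b hb₁
    have hc' := hmle c hc₁
    have hd' := hmle d hd₁
    rcases hsid a ha₁ b hb₁ c hc₁ d hd₁ (by omega) with h1 | h1
    · exact Or.inl (by rw [h1])
    · exact Or.inr (by rw [h1])
  have hZle : ∀ z ∈ Z, z ≤ M - m := by
    intro z hz
    obtain ⟨s, hs, rfl⟩ := hZmem z hz
    have := hleM s hs
    omega
  have h0Z : 0 ∈ Z := by simpa using hSZ m hmS
  have hLZ : M - m ∈ Z := hSZ M hMS
  have hfin : ∀ w ∈ masks, (∀ s ∈ S, w.testBit s = true) →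
      ∃ w ∈ masks, ∀ p, w.testBit p = true → p ∈ S := by
    intro w hw hwS
    refine ⟨w, hw, fun p hp => ?_⟩
    refine mem_of_testBit (card_masks w hw) hcard
      (fun s hs => ⟨by have := (hS s hs).2; omega, hwS s hs⟩) ?_ hp
    by_contra hlt
    rw [Nat.testBit_eq_false_of_lt ((masks_lt w hw).trans_le
      (Nat.pow_le_pow_right (by omega) (not_lt.1 hlt)))] at hp
    exact absurd hp (by simp)
  obtain ⟨q, hq, h | h⟩ := exists_code hZcard hZsid h0Z hLZ hZle (by omega)
  · have htop : ∀ p < 111, q.testBit p = true → p ≤ M - m := by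
      intro p hp hpq
      have : p ∈ Z.image fun z => M - m - z := by
        refine mem_of_testBit (card_codeList q hq) ?_ ?_ hp hpq
        · rw [Finset.card_image_of_injOn, hZcard]
          intro a ha b hb e
          have ha' := hZle a ha
          have hb' := hZle b hb
          simp only at e
          omega
        · intro c hc
          obtain ⟨z, hz, rfl⟩ := Finset.mem_image.1 hc
          exact ⟨by omega, h z hz⟩
      obtain ⟨z, hz, rfl⟩ := Finset.mem_image.1 this
      omega
    obtain ⟨-, w, hw, hwq⟩ := masks_complete q hq (M - m) (by omega) (by simpa using h 0 h0Z) htop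
      m (by omega) h1.1 (by omega)
    refine hfin w hw fun s hs => ?_
    have h4 := hmle s hs
    have h5 := hleM s hs
    have := hwq _ (by omega) (h _ (hSZ s hs))
    rwa [show m + (M - m - (M - m - (s - m))) = s by omega] at this
  · have htop : ∀ p < 111, q.testBit p = true → p ≤ M - m := by
      intro p hp hpq
      refine hZle p (mem_of_testBit (card_codeList q hq) hZcard (fun z hz => ⟨?_, h z hz⟩) hp hpq)
      have := hZle z hz
      omega
    obtain ⟨⟨w, hw, hwq⟩, -⟩ := masks_complete q hq (M - m) (by omega) (h _ hLZ) htop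
      m (by omega) h1.1 (by omega)
    refine hfin w hw fun s hs => ?_
    have h4 := hmle s hs
    have h5 := hleM s hs
    have := hwq _ (by omega) (h _ (hSZ s hs))
    rwa [show m + (s - m) = s by omega] at this

theorem exists_mask_int {S : Finset ℤ} (hcard : S.card = 13)
    (hsid : ∀ a ∈ S, ∀ b ∈ S, ∀ c ∈ S, ∀ d ∈ S, a + b = c + d → ({a, b} : Set ℤ) = {c, d})
    (hS : (S : Set ℤ) ⊆ Set.Icc 1 111) : ∃ w ∈ masks, ∀ p, w.testBit p = true → (p : ℤ) ∈ S := by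
  have hbd : ∀ s ∈ S, 1 ≤ s ∧ s ≤ 111 := fun s hs => hS hs
  have hmem : ∀ n ∈ S.image Int.toNat, (n : ℤ) ∈ S := by
    intro n hn
    obtain ⟨s, hs, rfl⟩ := Finset.mem_image.1 hn
    have := (hbd s hs).1
    rwa [Int.toNat_of_nonneg (by omega)]
  obtain ⟨w, hw, h⟩ := exists_mask (S := S.image Int.toNat)
    (by
      rw [Finset.card_image_of_injOn, hcard]
      intro a ha b hb e
      have h1 := (hbd a ha).1
      have h2 := (hbd b hb).1
      omega)
    (by
      intro a ha b hb c hc d hd e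
      have h1 : (a : ℤ) ∈ ({(c : ℤ), (d : ℤ)} : Set ℤ) := by
        rw [← hsid a (hmem a ha) b (hmem b hb) c (hmem c hc) d (hmem d hd) (by exact_mod_cast e)]
        exact Set.mem_insert _ _
      rw [Set.mem_insert_iff, Set.mem_singleton_iff] at h1
      rcases h1 with h1 | h1
      · exact Or.inl (by exact_mod_cast h1)
      · exact Or.inr (by exact_mod_cast h1))
    (by
      intro n hn
      have := hbd _ (hmem n hn)
      omega)
  exact ⟨w, hw, fun p hp => hmem p (h p hp)⟩

theorem not_disjoint_of_land_ne_zero {S T : Finset ℤ} {v w : ℕ}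
    (hv : ∀ p, v.testBit p = true → (p : ℤ) ∈ S) (hw : ∀ p, w.testBit p = true → (p : ℤ) ∈ T)
    (h : v &&& w ≠ 0) : ¬ Disjoint S T := by
  obtain ⟨p, hp⟩ := Nat.exists_testBit_of_ne_zero h
  rw [Nat.testBit_and, Bool.and_eq_true] at hp
  exact fun hd => Finset.disjoint_left.1 hd (hv p hp.1) (hw p hp.2)

end Golomb

theorem no_three_disjoint_13SS (S₁ S₂ S₃ : Finset ℤ)
    (h₁ : (S₁ : Set ℤ) ⊆ Set.Icc 1 111) (hS₁ : IsSidon (S₁ : Set ℤ)) (hc₁ : S₁.card = 13)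
    (h₂ : (S₂ : Set ℤ) ⊆ Set.Icc 1 111) (hS₂ : IsSidon (S₂ : Set ℤ)) (hc₂ : S₂.card = 13)
    (h₃ : (S₃ : Set ℤ) ⊆ Set.Icc 1 111) (hS₃ : IsSidon (S₃ : Set ℤ)) (hc₃ : S₃.card = 13) :
    ¬ (Disjoint S₁ S₂ ∧ Disjoint S₁ S₃ ∧ Disjoint S₂ S₃) := by
  obtain ⟨w₁, hw₁, hm₁⟩ := Golomb.exists_mask_int hc₁
    (fun a ha b hb c hc d hd => hS₁ a ha b hb c hc d hd) h₁
  obtain ⟨w₂, hw₂, hm₂⟩ := Golomb.exists_mask_int hc₂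
    (fun a ha b hb c hc d hd => hS₂ a ha b hb c hc d hd) h₂
  obtain ⟨w₃, hw₃, hm₃⟩ := Golomb.exists_mask_int hc₃
    (fun a ha b hb c hc d hd => hS₃ a ha b hb c hc d hd) h₃
  rintro ⟨h12, h13, h23⟩
  rcases Golomb.masks_meet w₁ hw₁ w₂ hw₂ w₃ hw₃ with h | h | h
  · exact Golomb.not_disjoint_of_land_ne_zero hm₁ hm₂ h h12
  · exact Golomb.not_disjoint_of_land_ne_zero hm₁ hm₃ h h13
  · exact Golomb.not_disjoint_of_land_ne_zero hm₂ hm₃ h h23
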